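/- arXiv:0910.1476 — 2 statements merged into one kernel-verified Lean document; each statement's English description precedes it below -/
import Mathlib

section
/- Let V be an equidimensional affine variety over ℂ of dimension r and let φ : V → ℂʳ be a morphism of affine varieties whose restriction to each irreducible component of V is dominating. Then every point y ∈ ℂʳ satisfies #_{isolated} φ^{-1}(y) ≤ deg φ, where #_{isolated} φ^{-1}(y) denotes the (finite) number of isolated points of the fiber φ^{-1}(y). In particular, if the fiber φ^{-1}(y) is finite, then # φ^{-1}(y) ≤ deg φ. -/
open MvPolynomial

noncomputable section

/-- The Zariski closure of a subset of the affine space `σ → ℂ`. -/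
def zcl {σ : Type} (T : Set (σ → ℂ)) : Set (σ → ℂ) :=
  MvPolynomial.zeroLocus ℂ (MvPolynomial.vanishingIdeal ℂ T)

/-- Zariski open subsets of the affine space `σ → ℂ`. -/
def ZOpen {σ : Type} (U : Set (σ → ℂ)) : Prop :=
  ∃ I : Ideal (MvPolynomial σ ℂ), U = {x | ∃ f ∈ I, MvPolynomial.eval x f ≠ 0}

/-- Zariski open subsets of the space of `m × n` complex matrices. -/
def ZOpenMat {m n : ℕ} (U : Set (Matrix (Fin m) (Fin n) ℂ)) : Prop :=
  ∃ I : Ideal (MvPolynomial (Fin m × Fin n) ℂ),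
    U = {a | ∃ f ∈ I, MvPolynomial.eval (fun q => a q.1 q.2) f ≠ 0}

/-- `T` is of pure dimension `d`: every irreducible component of (the Zariski closure of) `T`,
i.e. every minimal prime over its vanishing ideal, has coordinate ring of Krull dimension `d`. -/
def IsPureDim {σ : Type} (T : Set (σ → ℂ)) (d : ℕ) : Prop :=
  ∀ P ∈ (MvPolynomial.vanishingIdeal ℂ T).minimalPrimes,
    ringKrullDim (MvPolynomial σ ℂ ⧸ P) = (d : WithBot (WithTop ℕ))

/-- The Zariski tangent space at a point `x` of (the Zariski closure of) a subset `T`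
of affine space: the common kernel of the differentials at `x` of all polynomials
vanishing on `T`. -/
def tangentAt {σ : Type} [Fintype σ] [DecidableEq σ] (T : Set (σ → ℂ)) (x : σ → ℂ) :
    Submodule ℂ (σ → ℂ) :=
  ⨅ (f : MvPolynomial σ ℂ) (_ : f ∈ MvPolynomial.vanishingIdeal ℂ T),
    LinearMap.ker
      (∑ l, MvPolynomial.eval x (MvPolynomial.pderiv l f) •
        (LinearMap.proj l : (σ → ℂ) →ₗ[ℂ] ℂ))

/-- `rs` is a regular sequence in the commutative ring `R`. -/
def IsRegSeq {R : Type*} [CommRing R] (rs : List R) : Prop :=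
  Ideal.span {x | x ∈ rs} ≠ ⊤ ∧
  ∀ j, j < rs.length → ∀ b : R,
    rs.getD j 0 * b ∈ Ideal.span {x | x ∈ rs.take j} →
    b ∈ Ideal.span {x | x ∈ rs.take j}

/-- The common zero set in `ℂⁿ` of polynomials `F₁, …, F_p ∈ ℚ[X₁, …, Xₙ]`. -/
def zeroSetC {n p : ℕ} (F : Fin p → MvPolynomial (Fin n) ℚ) : Set (Fin n → ℂ) :=
  {x | ∀ k, MvPolynomial.aeval x (F k) = 0}

/-- The Jacobian matrix `[∂F_k/∂X_l]` evaluated at `x ∈ ℂⁿ`. -/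
def jacC {n p : ℕ} (F : Fin p → MvPolynomial (Fin n) ℚ) (x : Fin n → ℂ) :
    Matrix (Fin p) (Fin n) ℂ :=
  Matrix.of fun k l => MvPolynomial.aeval x (MvPolynomial.pderiv l (F k))

/-- The set of regular points of `S = {F₁ = 0, …, F_p = 0}`: points of `S` where the
Jacobian has maximal rank `p`. -/
def SregC {n p : ℕ} (F : Fin p → MvPolynomial (Fin n) ℚ) : Set (Fin n → ℂ) :=
  {x | x ∈ zeroSetC F ∧ (jacC F x).rank = p}

/-- The classic polar variety: the Zariski closure of the locus of regular points of `S`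
where the matrix obtained by appending the rows of `a` to the Jacobian has rank at
most `r` (i.e. where all `(r+1)`-minors vanish). -/
def Wclassic {n p m : ℕ} (F : Fin p → MvPolynomial (Fin n) ℚ)
    (a : Matrix (Fin m) (Fin n) ℂ) (r : ℕ) : Set (Fin n → ℂ) :=
  zcl {x | x ∈ SregC F ∧ (Matrix.fromRows (jacC F x) a).rank ≤ r}

/-- The dual polar variety: as `Wclassic`, with appended rows `(a_{k,1} - X₁, …, a_{k,n} - Xₙ)`. -/
def Wdual {n p m : ℕ} (F : Fin p → MvPolynomial (Fin n) ℚ)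
    (a : Matrix (Fin m) (Fin n) ℂ) (r : ℕ) : Set (Fin n → ℂ) :=
  zcl {x | x ∈ SregC F ∧
    (Matrix.fromRows (jacC F x) (Matrix.of fun k l => a k l - x l)).rank ≤ r}

/-- `F₁, …, F_p` generate the full vanishing ideal of their zero set (over `ℂ`);
this encodes that `(F₁, …, F_p)` is reduced (radical) and the ideal of definition of `S`. -/
def idealOfDef {n p : ℕ} (F : Fin p → MvPolynomial (Fin n) ℚ) : Prop :=
  MvPolynomial.vanishingIdeal ℂ (zeroSetC F) =
    Ideal.span (Set.range fun k => MvPolynomial.map (algebraMap ℚ ℂ) (F k))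

/-- The submatrix of the first `m` rows of a matrix. -/
def firstRows {N n' m : ℕ} (a : Matrix (Fin N) (Fin n') ℂ) (h : m ≤ N) :
    Matrix (Fin m) (Fin n') ℂ :=
  Matrix.of fun k l => a (Fin.castLE h k) l

/-- The matrix obtained by deleting row `h`. -/
def rowErase {m n' : ℕ} (a : Matrix (Fin (m + 1)) (Fin n') ℂ) (h : Fin (m + 1)) :
    Matrix (Fin m) (Fin n') ℂ :=
  Matrix.of fun k l => a (h.succAbove k) l

/-- The real trace `S_ℝ := S ∩ ℝⁿ`, as a subset of Euclidean space. -/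
def SR {n p : ℕ} (F : Fin p → MvPolynomial (Fin n) ℚ) : Set (EuclideanSpace ℝ (Fin n)) :=
  {x | (fun j => (x j : ℂ)) ∈ zeroSetC F}

/-- `C` is a connected component of `T`. -/
def IsConnCompOf {α : Type*} [TopologicalSpace α] (C T : Set α) : Prop :=
  C.Nonempty ∧ C ⊆ T ∧ IsPreconnected C ∧
    ∀ D, C ⊆ D → D ⊆ T → IsPreconnected D → D = C

end

noncomputable section

/-- The polynomial map `ℂᴺ → ℂʳ` given by an `r`-tuple of polynomials. -/
def polyMap {N r : ℕ} (G : Fin r → MvPolynomial (Fin N) ℂ) (x : Fin N → ℂ) : Fin r → ℂ :=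
  fun j => MvPolynomial.eval x (G j)

/-- The restriction of `φ = polyMap G` to each irreducible component of `V` is a
dominating morphism to `ℂʳ`. -/
def DominatesOnComponents {N r : ℕ} (V : Set (Fin N → ℂ))
    (G : Fin r → MvPolynomial (Fin N) ℂ) : Prop :=
  ∀ P ∈ (MvPolynomial.vanishingIdeal ℂ V).minimalPrimes,
    zcl (polyMap G '' MvPolynomial.zeroLocus ℂ P) = Set.univ

set_option synthInstance.maxHeartbeats 1000000 in
set_option maxHeartbeats 2000000 in
/-- The degree of the morphism `φ = polyMap G : V → ℂʳ`: the dimension of the total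
quotient ring `ℂ(V)` of `V` as a vector space over the rational function field `ℂ(ℂʳ)`;
here it is computed as the rank of `ℂ(V)` as a module over `ℂ[Y₁, …, Y_r]`, the module
structure being given by the ring homomorphism `ℂ[Y] → ℂ(V)` induced by `φ` (over the
domain `ℂ[Y]` this rank coincides with `dim_{ℂ(ℂʳ)} ℂ(V)`). -/
def degPhi {N r : ℕ} (V : Set (Fin N → ℂ)) (G : Fin r → MvPolynomial (Fin N) ℂ) :
    Cardinal :=
  letI : Module (MvPolynomial (Fin r) ℂ)
      (FractionRing (MvPolynomial (Fin N) ℂ ⧸ MvPolynomial.vanishingIdeal ℂ V)) :=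
    Module.compHom _
      ((algebraMap (MvPolynomial (Fin N) ℂ ⧸ MvPolynomial.vanishingIdeal ℂ V)
          (FractionRing (MvPolynomial (Fin N) ℂ ⧸ MvPolynomial.vanishingIdeal ℂ V))).comp
        ((Ideal.Quotient.mk (MvPolynomial.vanishingIdeal ℂ V)).comp
          (MvPolynomial.aeval G).toRingHom))
  Module.rank (MvPolynomial (Fin r) ℂ)
    (FractionRing (MvPolynomial (Fin N) ℂ ⧸ MvPolynomial.vanishingIdeal ℂ V))

/-- `x` is an isolated point of the algebraic set `T`. -/
def IsIsolatedIn {N : ℕ} (x : Fin N → ℂ) (T : Set (Fin N → ℂ)) : Prop :=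
  x ∈ T ∧ ∃ g : MvPolynomial (Fin N) ℂ, MvPolynomial.eval x g ≠ 0 ∧
    ∀ z ∈ T, MvPolynomial.eval z g ≠ 0 → z = x

end

/-- An integral element of a torsion-free algebra over an integrally closed domain satisfies a
monic equation of least degree among all nontrivial equations. -/
theorem exists_monic_aeval_eq_zero_natDegree_le {A B : Type*} [CommRing A] [IsDomain A]
    [IsIntegrallyClosed A] [CommRing B] [Algebra A B]
    (htf : ∀ (a : A) (x : B), a ≠ 0 → a • x = 0 → x = 0) {b : B} (hb : IsIntegral A b) :
    ∃ p : Polynomial A, p.Monic ∧ Polynomial.aeval b p = 0 ∧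
      ∀ q : Polynomial A, q ≠ 0 → Polynomial.aeval b q = 0 → p.natDegree ≤ q.natDegree := by
  classical
  obtain ⟨f, hf, hfb⟩ := hb
  rw [← Polynomial.aeval_def] at hfb
  have hex : ∃ n, ∃ q : Polynomial A, q ≠ 0 ∧ Polynomial.aeval b q = 0 ∧ q.natDegree = n :=
    ⟨_, f, hf.ne_zero, hfb, rfl⟩
  obtain ⟨q, hq0, hqb, hqn⟩ := Nat.find_spec hex
  have hmin : ∀ s : Polynomial A, s ≠ 0 → Polynomial.aeval b s = 0 → q.natDegree ≤ s.natDegree :=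
    fun s hs hsb ↦ hqn ▸ Nat.find_min' hex ⟨s, hs, hsb, rfl⟩
  let K := FractionRing A
  have hinj : Function.Injective (algebraMap A K) := IsFractionRing.injective A K
  have hqK : q.map (algebraMap A K) ≠ 0 := (Polynomial.map_ne_zero_iff hinj).mpr hq0
  have hdvd : q.map (algebraMap A K) ∣ f.map (algebraMap A K) := by
    rw [← EuclideanDomain.mod_eq_zero]
    by_contra hr
    set r := f.map (algebraMap A K) % q.map (algebraMap A K)
    set s := f.map (algebraMap A K) / q.map (algebraMap A K)
    have hdiv : q.map (algebraMap A K) * s + r = f.map (algebraMap A K) :=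
      EuclideanDomain.div_add_mod _ _
    obtain ⟨c, hc, hcr⟩ := IsLocalization.integerNormalization_spec (nonZeroDivisors A) r
    obtain ⟨d, hd, hds⟩ := IsLocalization.integerNormalization_spec (nonZeroDivisors A) s
    set r' := IsLocalization.integerNormalization (nonZeroDivisors A) r
    set s' := IsLocalization.integerNormalization (nonZeroDivisors A) s
    simp only [Algebra.smul_def, Polynomial.algebraMap_apply] at hcr hds
    have key : Polynomial.C c * q * s' + Polynomial.C d * r' = Polynomial.C (c * d) * f := by
      apply Polynomial.map_injective _ hinj
      simp only [Polynomial.map_add, Polynomial.map_mul, Polynomial.map_C, hcr, hds, ← hdiv,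
        map_mul]
      ring
    have hdr : d • Polynomial.aeval b r' = 0 := by
      have := congrArg (Polynomial.aeval b) key
      simpa [hqb, hfb, Algebra.smul_def] using this
    have hr'b := htf _ _ (nonZeroDivisors.ne_zero hd) hdr
    have hcK : algebraMap A K c ≠ 0 :=
      (map_ne_zero_iff _ hinj).mpr (nonZeroDivisors.ne_zero hc)
    have hr'0 : r' ≠ 0 := by
      intro h
      rw [h, Polynomial.map_zero] at hcr
      exact hr (by simpa [hcK] using hcr.symm)
    have h1 := hmin r' hr'0 hr'b
    have h2 : r'.natDegree = r.natDegree := by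
      rw [← Polynomial.natDegree_map_eq_of_injective hinj, hcr, Polynomial.natDegree_C_mul hcK]
    have h3 : r.degree < (q.map (algebraMap A K)).degree := EuclideanDomain.mod_lt _ hqK
    rw [Polynomial.degree_map_eq_of_injective hinj] at h3
    have := Polynomial.natDegree_lt_natDegree hr h3
    omega
  obtain ⟨p, hp⟩ := IsIntegrallyClosed.eq_map_mul_C_of_dvd K hf hdvd
  rw [Polynomial.leadingCoeff_map_of_injective hinj] at hp
  have hlc : q.leadingCoeff ≠ 0 := Polynomial.leadingCoeff_ne_zero.mpr hq0
  have hpq : p * Polynomial.C q.leadingCoeff = q := by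
    apply Polynomial.map_injective _ hinj
    simpa using hp
  refine ⟨p, ?_, ?_, ?_⟩
  · have := congrArg Polynomial.leadingCoeff hpq
    rw [Polynomial.leadingCoeff_mul, Polynomial.leadingCoeff_C] at this
    exact mul_right_cancel₀ hlc (by rw [this, one_mul])
  · apply htf _ _ hlc
    have := congrArg (Polynomial.aeval b) hpq
    rw [hqb] at this
    rw [Algebra.smul_def, mul_comm]
    simpa using this
  · intro s hs hsb
    rw [← Polynomial.natDegree_mul_C (p := p) hlc, hpq]
    exact hmin s hs hsb

theorem linearIndependent_pow_of_natDegree_le {A B : Type*} [CommRing A] [CommRing B]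
    [Algebra A B] {b : B} {n : ℕ}
    (h : ∀ q : Polynomial A, q ≠ 0 → Polynomial.aeval b q = 0 → n ≤ q.natDegree) :
    LinearIndependent A (fun i : Fin n ↦ b ^ (i : ℕ)) := by
  rw [Fintype.linearIndependent_iff]
  intro g hg i
  have h0 : (∑ j : Fin n, Polynomial.C (g j) * Polynomial.X ^ (j : ℕ) : Polynomial A) = 0 := by
    by_contra hne
    have h1 := h _ hne (by simpa [Algebra.smul_def] using hg)
    have h2 : (∑ j : Fin n, Polynomial.C (g j) * Polynomial.X ^ (j : ℕ) : Polynomial A).degree < n :=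
      Polynomial.degree_sum_fin_lt g
    rw [Polynomial.degree_eq_natDegree hne] at h2
    exact absurd (Nat.cast_lt.mp h2) (not_lt.mpr h1)
  have := congrArg (fun q : Polynomial A ↦ q.coeff i) h0
  simpa [Polynomial.finsetSum_coeff, Polynomial.coeff_C_mul, Polynomial.coeff_X_pow,
    Fin.val_inj] using this

/-- By Zariski's main theorem, rational points at which `B` is quasi-finite over `A` are separated
by a single element of the integral closure of `A` in `B`. -/
theorem exists_isIntegral_injective_algHom_apply {k A B ι : Type*} [Field k] [Infinite k]
    [CommRing A] [CommRing B] [Algebra k A] [Algebra A B] [Algebra k B] [IsScalarTower k A B]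
    [Algebra.FiniteType A B] [Finite ι] (χ : ι → B →ₐ[k] k) (hχ : Function.Injective χ)
    (hqf : ∀ i, haveI := RingHom.ker_isPrime (χ i); Algebra.QuasiFiniteAt A (RingHom.ker (χ i))) :
    ∃ b : B, IsIntegral A b ∧ Function.Injective fun i ↦ χ i b := by
  classical
  have := Fintype.ofFinite ι
  have hsep : ∀ i j, i ≠ j → ∃ b : integralClosure A B, χ i b ≠ χ j b := by
    intro i j hij
    by_contra! hcon
    have := RingHom.ker_isPrime (χ i)
    have := hqf i
    obtain ⟨f, hf, hfi, hfx⟩ := Algebra.zariskisMainProperty_iff.mp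
      (Algebra.ZariskisMainProperty.of_finiteType (R := A) (RingHom.ker (χ i)))
    refine hij (hχ (AlgHom.ext fun x ↦ ?_))
    obtain ⟨m, hm⟩ := hfx x
    have h1 := hcon ⟨_, hm⟩
    have h2 := hcon ⟨f, hfi⟩
    simp only [map_mul, map_pow] at h1 h2
    rw [← h2] at h1
    exact mul_left_cancel₀ (pow_ne_zero _ hf) h1
  let E : Submodule k B := (Subalgebra.toSubmodule (integralClosure A B)).restrictScalars k
  let D : ι × ι → Submodule k E := fun ij ↦
    LinearMap.ker (((χ ij.1).toLinearMap - (χ ij.2).toLinearMap).comp E.subtype)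
  have hD : ∀ ij ∈ Finset.univ.filter (fun ij : ι × ι ↦ ij.1 ≠ ij.2), D ij ≠ ⊤ := by
    rintro ⟨i, j⟩ hij htop
    obtain ⟨⟨b, hb⟩, hne⟩ := hsep i j (by simpa using hij)
    have : (⟨b, hb⟩ : E) ∈ D (i, j) := htop ▸ Submodule.mem_top
    exact hne (sub_eq_zero.mp (by simpa [D] using this))
  have hU := Subspace.biUnion_ne_univ_of_top_notMem
    (s := (Finset.univ.filter (fun ij : ι × ι ↦ ij.1 ≠ ij.2)).image D)
    (by simpa using fun i j h ↦ hD (i, j) (by simpa using h))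
  obtain ⟨⟨b, hb⟩, hbU⟩ := (Set.ne_univ_iff_exists_notMem _).mp hU
  refine ⟨b, hb, fun i j hij ↦ ?_⟩
  by_contra hne
  apply hbU
  simp only [Set.mem_iUnion]
  refine ⟨D (i, j), by simpa using ⟨i, j, hne, rfl⟩, ?_⟩
  simpa [D, sub_eq_zero] using hij

/-- For `A` integrally closed and `B` torsion-free over `A`, the number of quasi-finite rational
points in a fiber of `Spec B → Spec A` is at most the rank of `B`. -/
theorem card_le_rank_of_quasiFiniteAt {k A B ι : Type*} [Field k] [Infinite k]
    [CommRing A] [IsDomain A] [IsIntegrallyClosed A]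
    [CommRing B] [Algebra k A] [Algebra A B] [Algebra k B] [IsScalarTower k A B]
    [Algebra.FiniteType A B] [Fintype ι]
    (htf : ∀ (a : A) (x : B), a ≠ 0 → a • x = 0 → x = 0)
    (χ : ι → B →ₐ[k] k) (hχ : Function.Injective χ) (ψ : A →+* k)
    (hψ : ∀ i, (χ i : B →+* k).comp (algebraMap A B) = ψ)
    (hqf : ∀ i, haveI := RingHom.ker_isPrime (χ i); Algebra.QuasiFiniteAt A (RingHom.ker (χ i))) :
    (Fintype.card ι : Cardinal) ≤ Module.rank A B := by
  classical
  obtain ⟨b, hb, hinj⟩ := exists_isIntegral_injective_algHom_apply (A := A) χ hχ hqf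
  obtain ⟨p, hp, hpb, hmin⟩ := exists_monic_aeval_eq_zero_natDegree_le htf hb
  have hroot : ∀ i, (p.map ψ).IsRoot (χ i b) := by
    intro i
    rw [Polynomial.IsRoot.def, Polynomial.eval_map, ← hψ i]
    have := congrArg (χ i) hpb
    rw [map_zero, Polynomial.aeval_def] at this
    rw [← this]
    exact (Polynomial.hom_eval₂ p (algebraMap A B) (χ i : B →+* k) b).symm
  have hle : Fintype.card ι ≤ p.natDegree := by
    rw [← hp.natDegree_map ψ]
    rw [← Finset.card_univ, ← Finset.card_image_of_injective _ hinj]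
    refine Polynomial.card_le_degree_of_subset_roots fun c hc ↦ ?_
    obtain ⟨i, -, rfl⟩ := Finset.mem_image.mp hc
    exact (Polynomial.mem_roots (hp.map ψ).ne_zero).mpr (hroot i)
  have hli := linearIndependent_pow_of_natDegree_le hmin
  have hrank : (p.natDegree : Cardinal) ≤ Module.rank A B := by
    simpa using hli.cardinal_lift_le_rank
  exact le_trans (by exact_mod_cast hle) hrank

theorem rank_toAlgebra_le_rank_compHom.{u, v} {A : Type v} {B L : Type u} [CommRing A] [CommRing B]
    [CommRing L] (f : A →+* B) (g : B →+* L) (hg : Function.Injective g) :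
    @Module.rank A B _ _ f.toAlgebra.toModule ≤
      @Module.rank A L _ _ (Module.compHom L (g.comp f)) := by
  let := f.toAlgebra
  let : Module A L := Module.compHom L (g.comp f)
  let ι : B →ₗ[A] L :=
    { toFun := g
      map_add' := map_add g
      map_smul' := fun _ _ ↦ map_mul g _ _ }
  exact ι.rank_le_of_injective hg

theorem isIsolatedIn_finite {N : ℕ} (T : Set (Fin N → ℂ)) : {x | IsIsolatedIn x T}.Finite := by
  refine Set.Finite.of_finite_image (f := fun x ↦ vanishingIdeal ℂ {x})
    (((vanishingIdeal ℂ T).finite_minimalPrimes_of_isNoetherianRing).subset ?_) ?_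
  · rintro _ ⟨x, ⟨hxT, g, hgx, hg⟩, rfl⟩
    refine ⟨⟨inferInstance, vanishingIdeal_anti_mono (Set.singleton_subset_iff.mpr hxT)⟩, ?_⟩
    rintro Q ⟨hQ, hTQ⟩ hQx h hh
    refine (hQ.mem_or_mem (hTQ (?_ : g * h ∈ vanishingIdeal ℂ T))).resolve_left
      fun hgQ ↦ hgx ((mem_vanishingIdeal_singleton_iff x g).mp (hQx hgQ))
    intro z hz
    by_cases hgz : MvPolynomial.eval z g = 0
    · simp [MvPolynomial.aeval_eq_eval, hgz]
    · rw [hg z hz hgz, map_mul, (mem_vanishingIdeal_singleton_iff x h).mp hh, mul_zero]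
  · intro x _ y _ hxy
    funext i
    have : (X i - C (y i) : MvPolynomial (Fin N) ℂ) ∈ vanishingIdeal ℂ {x} := by
      change vanishingIdeal ℂ {x} = vanishingIdeal ℂ {y} at hxy
      rw [hxy, mem_vanishingIdeal_singleton_iff]
      simp
    rw [mem_vanishingIdeal_singleton_iff] at this
    simpa [sub_eq_zero] using this

theorem isIsolatedIn_of_finite {N : ℕ} {T : Set (Fin N → ℂ)} (hT : T.Finite) {x : Fin N → ℂ}
    (hx : x ∈ T) : IsIsolatedIn x T := by
  classical
  have hsep : ∀ z : Fin N → ℂ, ∃ g : MvPolynomial (Fin N) ℂ,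
      z ≠ x → MvPolynomial.eval x g ≠ 0 ∧ MvPolynomial.eval z g = 0 := by
    intro z
    by_cases hz : z = x
    · exact ⟨0, fun h ↦ absurd hz h⟩
    · obtain ⟨i, hi⟩ := Function.ne_iff.mp hz
      exact ⟨X i - C (z i), fun _ ↦ by simpa [sub_eq_zero] using hi.symm⟩
  choose g hg using hsep
  refine ⟨hx, ∏ z ∈ hT.toFinset.erase x, g z, ?_, fun z hz hgz ↦ ?_⟩
  · rw [map_prod, Finset.prod_ne_zero_iff]
    exact fun z hz ↦ (hg z (Finset.ne_of_mem_erase hz)).1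
  · by_contra hne
    refine hgz ?_
    rw [map_prod]
    exact Finset.prod_eq_zero (i := z) (by simp [hne, hz]) (hg z hne).2

section CoordinateRing

variable {N r : ℕ} (V : Set (Fin N → ℂ)) (G : Fin r → MvPolynomial (Fin N) ℂ)

/-- The coordinate ring of `V`. -/
abbrev CoordRing : Type := MvPolynomial (Fin N) ℂ ⧸ vanishingIdeal ℂ V

/-- The comorphism `ℂ[Y₁, …, Y_r] → ℂ[V]` of `polyMap G`, as an algebra structure. -/
noncomputable abbrev comorphismAlgebra : Algebra (MvPolynomial (Fin r) ℂ) (CoordRing V) :=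
  ((Ideal.Quotient.mk (vanishingIdeal ℂ V)).comp (MvPolynomial.aeval G).toRingHom).toAlgebra

variable {V} in
/-- Evaluation of regular functions at a point of `V`. -/
noncomputable def evalAt {x : Fin N → ℂ} (hx : x ∈ V) : CoordRing V →ₐ[ℂ] ℂ :=
  Ideal.Quotient.liftₐ _ (MvPolynomial.aeval x) fun _ hf ↦ hf x hx

variable {V} in
@[simp]
theorem evalAt_mk {x : Fin N → ℂ} (hx : x ∈ V) (f : MvPolynomial (Fin N) ℂ) :
    evalAt hx (Ideal.Quotient.mk _ f) = MvPolynomial.eval x f := rfl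

theorem eval_aeval_eq_eval_polyMap (x : Fin N → ℂ) (a : MvPolynomial (Fin r) ℂ) :
    MvPolynomial.eval x (MvPolynomial.aeval G a) = MvPolynomial.eval (polyMap G x) a := by
  change ((MvPolynomial.eval x).comp (MvPolynomial.aeval G).toRingHom) a = _
  congr 1
  ext <;> simp [polyMap]

theorem isScalarTower_comorphismAlgebra :
    letI := comorphismAlgebra V G
    IsScalarTower ℂ (MvPolynomial (Fin r) ℂ) (CoordRing V) := by
  let := comorphismAlgebra V G
  refine IsScalarTower.of_algebraMap_eq fun c ↦ ?_
  change _ = Ideal.Quotient.mk (vanishingIdeal ℂ V) (MvPolynomial.aeval G (C c))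
  rw [MvPolynomial.aeval_C]
  rfl

variable {V G}

theorem mem_vanishingIdeal_of_aeval_mul_mem (hdom : DominatesOnComponents V G)
    {a : MvPolynomial (Fin r) ℂ} (ha : a ≠ 0) {f : MvPolynomial (Fin N) ℂ}
    (h : MvPolynomial.aeval G a * f ∈ vanishingIdeal ℂ V) : f ∈ vanishingIdeal ℂ V := by
  have hrad : (vanishingIdeal ℂ V).IsRadical := by
    rintro g ⟨n, hn⟩ x hx
    have := hn x hx
    rw [map_pow] at this
    exact eq_zero_of_pow_eq_zero this
  rw [← hrad.radical, ← Ideal.sInf_minimalPrimes, Ideal.mem_sInf]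
  intro P hP
  refine (hP.1.1.mem_or_mem (hP.1.2 h)).resolve_left fun haP ↦ ha ?_
  have hmem : a ∈ vanishingIdeal ℂ (polyMap G '' zeroLocus ℂ P) := by
    rintro _ ⟨x, hx, rfl⟩
    have := hx _ haP
    exact (eval_aeval_eq_eval_polyMap G x a).symm.trans this
  refine MvPolynomial.funext fun z ↦ ?_
  have hz : z ∈ zcl (polyMap G '' zeroLocus ℂ P) := hdom P hP ▸ Set.mem_univ z
  simpa [MvPolynomial.aeval_eq_eval] using hz a hmem

theorem quasiFiniteAt_ker_evalAt (hV : zcl V = V) {x : Fin N → ℂ} {y : Fin r → ℂ}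
    (hx : IsIsolatedIn x {x ∈ V | polyMap G x = y}) :
    letI := comorphismAlgebra V G
    haveI := RingHom.ker_isPrime (evalAt hx.1.1)
    Algebra.QuasiFiniteAt (MvPolynomial (Fin r) ℂ) (RingHom.ker (evalAt hx.1.1)) := by
  let := comorphismAlgebra V G
  have hprime := RingHom.ker_isPrime (evalAt hx.1.1)
  have := isScalarTower_comorphismAlgebra V G
  have : Algebra.FiniteType (MvPolynomial (Fin r) ℂ) (CoordRing V) :=
    .of_restrictScalars_finiteType ℂ _ _
  obtain ⟨⟨hxV, hxy⟩, g, hgx, hg⟩ := hx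
  let q : PrimeSpectrum (CoordRing V) := ⟨RingHom.ker (evalAt hxV), hprime⟩
  refine Algebra.QuasiFiniteAt.of_isOpen_singleton_fiber q ?_
  refine isOpen_induced_iff.mpr
    ⟨_, (PrimeSpectrum.basicOpen (Ideal.Quotient.mk (vanishingIdeal ℂ V) g)).isOpen, ?_⟩
  ext ⟨Q, hQ⟩
  simp only [Set.mem_preimage, Set.mem_singleton_iff] at hQ
  simp only [Set.mem_preimage, SetLike.mem_coe, PrimeSpectrum.mem_basicOpen,
    Set.mem_singleton_iff]
  constructor
  swap
  · intro h hgQ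
    obtain rfl : Q = q := congrArg Subtype.val h
    exact hgx hgQ
  intro hgQ
  have hcomap : ∀ a : MvPolynomial (Fin r) ℂ,
      Ideal.Quotient.mk (vanishingIdeal ℂ V) (MvPolynomial.aeval G a) ∈ Q.asIdeal ↔
        MvPolynomial.eval y a = 0 := by
    intro a
    have h1 : a ∈ (PrimeSpectrum.comap (algebraMap _ (CoordRing V)) Q).asIdeal ↔
      a ∈ (PrimeSpectrum.comap (algebraMap _ (CoordRing V)) q).asIdeal := by rw [hQ]
    refine h1.trans ?_
    change evalAt hxV (Ideal.Quotient.mk _ (MvPolynomial.aeval G a)) = 0 ↔ _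
    rw [evalAt_mk, eval_aeval_eq_eval_polyMap, hxy]
  let P : Ideal (MvPolynomial (Fin N) ℂ) := Q.asIdeal.comap (Ideal.Quotient.mk _)
  have hP : P.IsPrime := inferInstance
  have hle : RingHom.ker (evalAt hxV) ≤ Q.asIdeal := by
    intro h hh
    obtain ⟨h, rfl⟩ := Ideal.Quotient.mk_surjective h
    have hmem : g * h ∈ P := by
      rw [← MvPolynomial.IsPrime.vanishingIdeal_zeroLocus (K := ℂ) P]
      intro z hz
      have hzV : z ∈ V := by
        rw [← hV]
        intro f hf
        refine hz f ?_
        simp [P, Ideal.Quotient.eq_zero_iff_mem.mpr hf]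
      have hzy : polyMap G z = y := by
        funext j
        have := hz (G j - C (y j)) (by
          have := (hcomap (X j - C (y j))).mpr (by simp)
          simpa [P] using this)
        simpa [polyMap, sub_eq_zero, MvPolynomial.aeval_eq_eval] using this
      rw [map_mul]
      by_cases hgz : MvPolynomial.eval z g = 0
      · simp [MvPolynomial.aeval_eq_eval, hgz]
      · rw [hg z ⟨hzV, hzy⟩ hgz]
        have : MvPolynomial.eval x h = 0 := hh
        simp [MvPolynomial.aeval_eq_eval, this]
    exact (hP.mem_or_mem hmem).resolve_left hgQ
  have hmax : (RingHom.ker (evalAt hxV)).IsMaximal :=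
    RingHom.ker_isMaximal_of_surjective _ fun c ↦ ⟨algebraMap ℂ _ c, by simp⟩
  exact Subtype.ext (PrimeSpectrum.ext (hmax.eq_of_le Q.isPrime.ne_top hle).symm)

theorem card_le_degPhi_of_isIsolatedIn (hV : zcl V = V) (hdom : DominatesOnComponents V G)
    (y : Fin r → ℂ) :
    Cardinal.mk {x : Fin N → ℂ // IsIsolatedIn x {x ∈ V | polyMap G x = y}} ≤ degPhi V G := by
  let := comorphismAlgebra V G
  have := isScalarTower_comorphismAlgebra V G
  have : Algebra.FiniteType (MvPolynomial (Fin r) ℂ) (CoordRing V) :=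
    .of_restrictScalars_finiteType ℂ _ _
  have : Fintype {x : Fin N → ℂ // IsIsolatedIn x {x ∈ V | polyMap G x = y}} :=
    (isIsolatedIn_finite _).fintype
  rw [Cardinal.mk_fintype]
  refine (card_le_rank_of_quasiFiniteAt (A := MvPolynomial (Fin r) ℂ) (B := CoordRing V) ?_
    (fun x : {x : Fin N → ℂ // IsIsolatedIn x {x ∈ V | polyMap G x = y}} ↦ evalAt x.2.1.1) ?_
    (MvPolynomial.eval y) ?_ fun x ↦ quasiFiniteAt_ker_evalAt hV x.2).trans ?_
  · intro a f ha haf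
    obtain ⟨f, rfl⟩ := Ideal.Quotient.mk_surjective f
    refine Ideal.Quotient.eq_zero_iff_mem.mpr (mem_vanishingIdeal_of_aeval_mul_mem hdom ha ?_)
    rw [← Ideal.Quotient.eq_zero_iff_mem, map_mul]
    exact haf
  · intro x x' h
    refine Subtype.ext (funext fun i ↦ ?_)
    simpa using congrArg (fun χ : CoordRing V →ₐ[ℂ] ℂ ↦ χ (Ideal.Quotient.mk _ (X i))) h
  · intro x
    ext a
    · change evalAt x.2.1.1 (Ideal.Quotient.mk _ (MvPolynomial.aeval G (C a))) = _
      rw [evalAt_mk, eval_aeval_eq_eval_polyMap, x.2.1.2]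
      rfl
    · change evalAt x.2.1.1 (Ideal.Quotient.mk _ (MvPolynomial.aeval G (X a))) = _
      rw [evalAt_mk, eval_aeval_eq_eval_polyMap, x.2.1.2]
  · exact rank_toAlgebra_le_rank_compHom _ _ (IsFractionRing.injective _ _)

end CoordinateRing

/-- Lemma 5 (i) of the paper. Let `V ⊆ ℂᴺ` be an equidimensional
affine variety of dimension `r` and let `φ : V → ℂʳ` be a morphism of affine varieties
(given by polynomials `G`) whose restriction to each irreducible component of `V` is
dominating. Then for every `y ∈ ℂʳ` the number of isolated points of the fiber
`φ⁻¹(y)` is at most `deg φ`; in particular, if the fiber is finite, its cardinality is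
at most `deg φ`. -/
theorem statement15 {N r : ℕ} (V : Set (Fin N → ℂ))
    (hVclosed : zcl V = V) (hVne : V.Nonempty) (hVdim : IsPureDim V r)
    (G : Fin r → MvPolynomial (Fin N) ℂ)
    (hdom : DominatesOnComponents V G) :
    ∀ y : Fin r → ℂ,
      Cardinal.mk {x : Fin N → ℂ // IsIsolatedIn x {x ∈ V | polyMap G x = y}} ≤
        degPhi V G ∧
      ({x ∈ V | polyMap G x = y}.Finite →
        Cardinal.mk ↥{x ∈ V | polyMap G x = y} ≤ degPhi V G) := by
  intro y
  have h := card_le_degPhi_of_isIsolatedIn hVclosed hdom y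
  refine ⟨h, fun hfin ↦ le_trans ?_ h⟩
  exact Cardinal.mk_le_mk_of_subset fun x hx ↦ isIsolatedIn_of_finite hfin hx
end

section
/- Let a = [a_{k,l}] ∈ ℂ^{(n−p)×n} be such that for every 1 ≤ i ≤ n−p the submatrix a^{(i)} has maximal rank n−p−i+1 and the polar varieties W_{K(\underline{a^{(i)}})}(S) and W_{\bar K(\bar{a^{(i)}})}(S) are empty or of pure codimension i in S. Let U be a nonempty Zariski open set of matrices b = [b_{k,l}] ∈ ℂ^{(n−p)×n} such that for each b ∈ U and each 1 ≤ i ≤ n−p the submatrix b^{(i)} has maximal rank n−p−i+1 and the polar varieties W_{K(\underline{b^{(i)}})}(S) and W_{\bar K(\bar{b^{(i)}})}(S) are uniformly (in b) empty or of codimension i in S and have fixed geometric degrees δ_classic^{(i)} and δ_dual^{(i)}. Suppose finally that for each 1 ≤ i ≤ n−p, nonemptiness of W_{K(\underline{a^{(i)}})}(S) (resp. of W_{\bar K(\bar{a^{(i)}})}(S)) implies nonemptiness of W_{K(\underline{b^{(i)}})}(S) (resp. of W_{\bar K(\bar{b^{(i)}})}(S)) for b ∈ U. Then for every 1 ≤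 i ≤ n−p one has deg W_{K(\underline{a^{(i)}})}(S) ≤ δ_classic^{(i)} and deg W_{\bar K(\bar{a^{(i)}})}(S) ≤ δ_dual^{(i)}. -/
open MvPolynomial

/-- The geometric degree of an affine variety `V ⊆ ℂⁿ` (with `deg ∅ = 0`): the supremum
of the (finite) cardinalities of the intersections `V ∩ E` with affine-linear
subvarieties `E` of `ℂⁿ` for which this intersection is finite (Heintz's definition of
the geometric degree, which agrees with the sum of the degrees of the irreducible
components). -/
noncomputable def geomDeg {n : ℕ} (V : Set (Fin n → ℂ)) : ℕ∞ :=
  sSup {d : ℕ∞ | ∃ E : AffineSubspace ℂ (Fin n → ℂ),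
    (V ∩ ↑E).Finite ∧ ((V ∩ ↑E).ncard : ℕ∞) = d}

section

open TensorProduct
open scoped Matrix

/-- Closed points of a finitely generated `ℂ`-algebra are `ℂ`-rational. -/
theorem exists_algHom_ker_eq {A : Type*} [CommRing A] [Algebra ℂ A] [Algebra.FiniteType ℂ A]
    (m : Ideal A) [m.IsMaximal] : ∃ e : A →ₐ[ℂ] ℂ, RingHom.ker e = m := by
  let : Field (A ⧸ m) := Ideal.Quotient.field m
  have : Module.Finite ℂ (A ⧸ m) := finite_of_finite_type_of_isJacobsonRing ℂ (A ⧸ m)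
  have hb : Function.Bijective (algebraMap ℂ (A ⧸ m)) :=
    IsAlgClosed.algebraMap_bijective_of_isIntegral
  let φ : ℂ ≃ₐ[ℂ] (A ⧸ m) := AlgEquiv.ofBijective (Algebra.ofId ℂ (A ⧸ m)) hb
  refine ⟨φ.symm.toAlgHom.comp (Ideal.Quotient.mkₐ ℂ m), ?_⟩
  ext x
  simp [RingHom.mem_ker, Ideal.Quotient.eq_zero_iff_mem]

theorem AlgHom.surjective_to_base {A : Type*} [CommRing A] [Algebra ℂ A] (e : A →ₐ[ℂ] ℂ) :
    Function.Surjective e := fun c => ⟨algebraMap ℂ A c, by simp⟩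

instance AlgHom.isMaximal_ker_to_base {A : Type*} [CommRing A] [Algebra ℂ A] (e : A →ₐ[ℂ] ℂ) :
    (RingHom.ker e).IsMaximal :=
  RingHom.ker_isMaximal_of_surjective e e.surjective_to_base

theorem MvPolynomial.height_fin_of_isMaximal {k : Type*} [Field k] {n : ℕ}
    (m : Ideal (MvPolynomial (Fin n) k)) [m.IsMaximal] : m.height = n := by
  induction n with
  | zero =>
    have h := Ideal.height_le_ringKrullDim_of_ne_top (I := m) (Ideal.IsPrime.ne_top')
    rw [MvPolynomial.ringKrullDim_of_isNoetherianRing] at h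
    simpa using h
  | succ n ih =>
    let e := (MvPolynomial.finSuccEquiv k n).toRingEquiv
    have h1 : (m.map e).IsMaximal := Ideal.map_isMaximal_of_equiv e
    rw [← e.height_map m]
    have : ((m.map e).under (MvPolynomial (Fin n) k)).IsMaximal := by
      exact Polynomial.isMaximal_comap_C_of_isJacobsonRing _
    have : (m.map e).LiesOver ((m.map e).under (MvPolynomial (Fin n) k)) := ⟨rfl⟩
    rw [Polynomial.height_eq_height_add_one ((m.map e).under (MvPolynomial (Fin n) k)), ih]
    simp

theorem MvPolynomial.height_of_isMaximal {k σ : Type*} [Field k] [Fintype σ]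
    (m : Ideal (MvPolynomial σ k)) [m.IsMaximal] : m.height = Fintype.card σ := by
  let e := (MvPolynomial.renameEquiv k (Fintype.equivFin σ)).toRingEquiv
  have h1 : (m.map e).IsMaximal := Ideal.map_isMaximal_of_equiv e
  rw [← e.height_map m, MvPolynomial.height_fin_of_isMaximal]

theorem ringKrullDim_le_of_isIntegral (R S : Type*) [CommRing R] [CommRing S] [Algebra R S]
    [Algebra.IsIntegral R S] : ringKrullDim S ≤ ringKrullDim R :=
  Order.krullDim_le_of_strictMono (PrimeSpectrum.comap (algebraMap R S)) fun I J h => by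
    have := I.2
    exact Ideal.IsIntegral.comap_lt_comap (R := R) (I := I.asIdeal) (J := J.asIdeal) h

/-- In an affine domain all maximal ideals have the height prescribed by a
Noether normalization, whose number of variables is the Krull dimension. -/
theorem exists_noether_normalization_height (k A : Type*) [Field k] [CommRing A] [IsDomain A]
    [Algebra k A] [Algebra.FiniteType k A] :
    ∃ (s : ℕ) (g : MvPolynomial (Fin s) k →ₐ[k] A), Function.Injective g ∧ g.Finite ∧
      ringKrullDim A = s ∧ ∀ m : Ideal A, m.IsMaximal → (s : ℕ∞) ≤ m.height := by
  obtain ⟨s, g, hg, hfin⟩ := exists_finite_inj_algHom_of_fg k A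
  refine ⟨s, g, hg, hfin, ?_⟩
  let := g.toRingHom.toAlgebra
  have : Module.Finite (MvPolynomial (Fin s) k) A := hfin
  have : FaithfulSMul (MvPolynomial (Fin s) k) A :=
    (faithfulSMul_iff_algebraMap_injective _ _).2 hg
  have : IsNoetherianRing A := Algebra.FiniteType.isNoetherianRing k A
  have hht : ∀ m : Ideal A, m.IsMaximal → (s : ℕ∞) ≤ m.height := by
    intro m hm
    have := Ideal.isMaximal_comap_of_isIntegral_of_isMaximal (R := MvPolynomial (Fin s) k) m
    have : (m.under (MvPolynomial (Fin s) k)).IsMaximal := this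
    rw [Ideal.height_eq_height_add_of_liesOver_of_hasGoingDown
      (m.under (MvPolynomial (Fin s) k)) m, MvPolynomial.height_fin_of_isMaximal]
    exact le_self_add
  refine ⟨le_antisymm ?_ ?_, hht⟩
  · refine (ringKrullDim_le_of_isIntegral (MvPolynomial (Fin s) k) A).trans ?_
    rw [MvPolynomial.ringKrullDim_of_isNoetherianRing]
    simp
  · obtain ⟨m, hm⟩ := Ideal.exists_maximal A
    exact (WithBot.coe_le_coe.2 (hht m hm)).trans
      (Ideal.height_le_ringKrullDim_of_ne_top hm.ne_top)

theorem AlgebraicIndependent.le_ringKrullDim {k A : Type} [Field k] [CommRing A] [IsDomain A]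
    [Algebra k A] [Algebra.FiniteType k A] {e : ℕ} {g : Fin e → A}
    (hg : AlgebraicIndependent k g) : (e : WithBot ℕ∞) ≤ ringKrullDim A := by
  obtain ⟨s, φ, hφ, hfin, hdim, -⟩ := exists_noether_normalization_height k A
  rw [hdim]
  have h1 := hg.cardinalMk_le_trdeg
  have h2 : Algebra.trdeg k A ≤ s := by
    have hr : φ.range = Algebra.adjoin k (Set.range fun i => φ (X i)) := by
      rw [← Algebra.map_top, ← MvPolynomial.adjoin_range_X, AlgHom.map_adjoin, ← Set.range_comp]
      rfl
    have : Algebra.IsAlgebraic (Algebra.adjoin k (Set.range fun i => φ (X i))) A := by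
      rw [← hr]
      refine ⟨fun x => ?_⟩
      have hx : IsIntegral φ.range x := by
        obtain ⟨p, hp, hpx⟩ := hfin.to_isIntegral x
        refine ⟨p.map φ.rangeRestrict.toRingHom, hp.map _, ?_⟩
        rw [Polynomial.eval₂_map]
        exact hpx
      exact hx.isAlgebraic
    refine (Algebra.IsAlgebraic.trdeg_le_cardinalMk k (Set.range fun i => φ (X i))).trans ?_
    exact Cardinal.mk_range_le.trans (by simp)
  have h3 := h1.trans h2
  simp only [Cardinal.mk_fintype, Fintype.card_fin] at h3
  exact_mod_cast h3

/-- Finitely many closed points of an affine algebra, seen as one closed point of a tensor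
power of the algebra. -/
theorem exists_pi_point {A : Type} [CommRing A] [Algebra ℂ A] [Algebra.FiniteType ℂ A] {N D : ℕ}
    (ev : Fin N → A →ₐ[ℂ] ℂ) (h : ∀ j, (D : ℕ∞) ≤ (RingHom.ker (ev j)).height) :
    ∃ (B : Type) (_ : CommRing B) (_ : Algebra ℂ B) (_ : Algebra.FiniteType ℂ B)
      (ι : Fin N → A →ₐ[ℂ] B) (e : B →ₐ[ℂ] ℂ), (∀ j, e.comp (ι j) = ev j) ∧
      RingHom.ker e ≤ ⨆ j, (RingHom.ker (ev j)).map (ι j) ∧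
      ((N * D : ℕ) : ℕ∞) ≤ (RingHom.ker e).height := by
  induction N with
  | zero =>
    refine ⟨ℂ, inferInstance, inferInstance, inferInstance, fun j => j.elim0, AlgHom.id ℂ ℂ,
      fun j => j.elim0, ?_, by simp⟩
    intro x hx
    simp [RingHom.mem_ker] at hx
    simp [hx]
  | succ N ih =>
    obtain ⟨B, _, _, _, ι, e, he, hker, hht⟩ := ih (fun j => ev j.succ) (fun j => h j.succ)
    let ι' : Fin (N + 1) → A →ₐ[ℂ] (B ⊗[ℂ] A) := fun j =>
      Fin.cases Algebra.TensorProduct.includeRight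
        (fun j => Algebra.TensorProduct.includeLeft.comp (ι j)) j
    let e' : (B ⊗[ℂ] A) →ₐ[ℂ] ℂ :=
      Algebra.TensorProduct.lift e (ev 0) (fun _ _ => Commute.all _ _)
    have hft : Algebra.FiniteType ℂ (B ⊗[ℂ] A) :=
      Algebra.FiniteType.trans (S := B) inferInstance inferInstance
    have hfac : e' = (Algebra.TensorProduct.lmul' ℂ (S := ℂ)).comp
        (Algebra.TensorProduct.map e (ev 0)) := by
      ext <;> simp [e']
    have hinj : Function.Injective (Algebra.TensorProduct.lmul' ℂ (S := ℂ)) := by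
      have : (Algebra.TensorProduct.lmul' ℂ (S := ℂ)) =
          (Algebra.TensorProduct.lid ℂ ℂ).toAlgHom := by
        ext
      rw [this]
      exact (Algebra.TensorProduct.lid ℂ ℂ).injective
    have hker' : RingHom.ker e' =
        (RingHom.ker e).map (Algebra.TensorProduct.includeLeft : B →ₐ[ℂ] (B ⊗[ℂ] A)) ⊔
        (RingHom.ker (ev 0)).map (Algebra.TensorProduct.includeRight : A →ₐ[ℂ] (B ⊗[ℂ] A)) := by
      rw [← Algebra.TensorProduct.map_ker e (ev 0) e.surjective_to_base
        (ev 0).surjective_to_base, hfac]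
      ext x
      simp only [RingHom.mem_ker, AlgHom.comp_apply]
      exact map_eq_zero_iff _ hinj
    refine ⟨B ⊗[ℂ] A, inferInstance, inferInstance, inferInstance, ι', e', ?_, ?_, ?_⟩
    · intro j
      refine Fin.cases ?_ (fun j => ?_) j
      · ext x; simp [ι', e']
      · rw [← he j]; ext x; simp [ι', e']
    · rw [hker']
      refine sup_le ?_ ?_
      · refine (Ideal.map_mono hker).trans ?_
        rw [Ideal.map_iSup]
        refine iSup_le fun j => ?_
        rw [Ideal.map_mapₐ]
        exact le_iSup (fun j => (RingHom.ker (ev j)).map (ι' j)) j.succ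
      · exact le_iSup (fun j => (RingHom.ker (ev j)).map (ι' j)) 0
    · have hl : (RingHom.ker e').LiesOver (RingHom.ker e) := by
        refine ⟨?_⟩
        ext x
        simp [RingHom.mem_ker, Ideal.mem_comap, e', Algebra.TensorProduct.algebraMap_def]
      have : IsNoetherianRing B := Algebra.FiniteType.isNoetherianRing ℂ _
      have : IsNoetherianRing (B ⊗[ℂ] A) := Algebra.FiniteType.isNoetherianRing ℂ _
      rw [Ideal.height_eq_height_add_of_liesOver_of_hasGoingDown (RingHom.ker e)]
      let φ : (B ⊗[ℂ] A) →ₐ[ℂ] A := (Algebra.TensorProduct.lid ℂ A).toAlgHom.comp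
        (Algebra.TensorProduct.map e (AlgHom.id ℂ A))
      have hφ : Function.Surjective φ := fun x => ⟨1 ⊗ₜ x, by simp [φ]⟩
      have hkφ : (RingHom.ker e).map (algebraMap B (B ⊗[ℂ] A)) = RingHom.ker φ := by
        have h1 := Algebra.TensorProduct.map_ker e (AlgHom.id ℂ A) e.surjective_to_base
          Function.surjective_id
        have h2 : RingHom.ker (AlgHom.id ℂ A) = ⊥ := by
          ext x; simp [RingHom.mem_ker]
        rw [h2, Ideal.map_bot, sup_bot_eq] at h1
        have h3 : (RingHom.ker e).map (algebraMap B (B ⊗[ℂ] A)) = 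
          (RingHom.ker e).map (Algebra.TensorProduct.includeLeft : B →ₐ[ℂ] (B ⊗[ℂ] A)) := rfl
        rw [h3, ← h1]
        ext x
        simp [RingHom.mem_ker, φ]
      have hev : ∀ x, ev 0 (φ x) = e' x := by
        have : (ev 0).comp φ = e' := by
          ext <;> simp [φ, e']
        exact fun x => DFunLike.congr_fun this x
      rw [hkφ]
      let ψ := (Ideal.quotientKerAlgEquivOfSurjective hφ).toRingEquiv
      have h4 : (D : ℕ∞) ≤ ((RingHom.ker e').map (Ideal.Quotient.mk (RingHom.ker φ))).height := by
        refine (h 0).trans ?_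
        rw [← ψ.height_comap]
        refine Ideal.height_mono ?_
        intro x hx
        obtain ⟨y, rfl⟩ := Ideal.Quotient.mk_surjective x
        refine Ideal.mem_map_of_mem _ ?_
        rw [RingHom.mem_ker, ← hev]
        exact hx
      calc (((N + 1) * D : ℕ) : ℕ∞) = ((N * D : ℕ) : ℕ∞) + (D : ℕ∞) := by push_cast; ring
        _ ≤ _ := add_le_add hht h4

theorem exists_algHom_of_notMem_prime {Q : Type*} [CommRing Q] [Algebra ℂ Q]
    [Algebra.FiniteType ℂ Q] (q : Ideal Q) [hq : q.IsPrime] {h : Q} (hh : h ∉ q) :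
    ∃ e : Q →ₐ[ℂ] ℂ, q ≤ RingHom.ker e ∧ e h ≠ 0 := by
  have : IsJacobsonRing Q := isJacobsonRing_of_finiteType (A := ℂ)
  have h1 : h ∉ q.jacobson := by
    rwa [IsJacobsonRing.out ‹_› hq.isRadical]
  rw [Ideal.jacobson, Submodule.mem_sInf] at h1
  push Not at h1
  obtain ⟨m, ⟨hqm, hm⟩, hhm⟩ := h1
  obtain ⟨e, he⟩ := exists_algHom_ker_eq m
  exact ⟨e, he ▸ hqm, fun h0 => hhm (he ▸ h0)⟩

theorem Polynomial.exists_X_sub_C_mem_of_prime (I : Ideal (Polynomial ℂ)) [hI : I.IsPrime]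
    {f : Polynomial ℂ} (hf : f ≠ 0) (hfI : f ∈ I) :
    ∃ c : ℂ, (Polynomial.X - Polynomial.C c) ∈ I := by
  rw [(IsAlgClosed.splits f).eq_prod_roots] at hfI
  rcases hI.mem_or_mem hfI with h | h
  · refine absurd (I.eq_top_of_isUnit_mem h ?_) hI.ne_top
    rw [Polynomial.isUnit_C]
    simpa using hf
  · obtain ⟨q, hq, hqI⟩ := (hI.multiset_prod_mem_iff_exists_mem _).1 h
    obtain ⟨c, -, rfl⟩ := Multiset.mem_map.1 hq
    exact ⟨c, hqI⟩

/-- An affine domain over the line in which the coordinate takes no constant value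
has points, avoiding a given hypersurface, over all but finitely many points of the line. -/
theorem exists_algHom_over_line {Q : Type*} [CommRing Q] [IsDomain Q] [Algebra ℂ Q]
    [Algebra.FiniteType ℂ Q] (x h : Q) (hh : h ≠ 0) (hx : ∀ c : ℂ, x ≠ algebraMap ℂ Q c) :
    ∃ f : Polynomial ℂ, f ≠ 0 ∧ ∀ c, f.eval c ≠ 0 → ∃ e : Q →ₐ[ℂ] ℂ, e x = c ∧ e h ≠ 0 := by
  let φ : Polynomial ℂ →ₐ[ℂ] Q := Polynomial.aeval x
  let : Algebra (Polynomial ℂ) Q := φ.toRingHom.toAlgebra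
  have hφ : ∀ f, algebraMap (Polynomial ℂ) Q f = φ f := fun _ => rfl
  have hinj : Function.Injective (algebraMap (Polynomial ℂ) Q) := by
    rw [injective_iff_map_eq_zero]
    intro f hf
    by_contra hf0
    have : (RingHom.ker φ).IsPrime := RingHom.ker_isPrime _
    obtain ⟨c, hc⟩ := Polynomial.exists_X_sub_C_mem_of_prime (RingHom.ker φ) hf0 hf
    refine hx c (sub_eq_zero.1 ?_)
    have hc' : φ (Polynomial.X - Polynomial.C c) = 0 := hc
    simpa [φ] using hc'
  have : FaithfulSMul (Polynomial ℂ) Q := (faithfulSMul_iff_algebraMap_injective _ _).2 hinj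
  have : IsScalarTower ℂ (Polynomial ℂ) Q := IsScalarTower.of_algebraMap_eq fun c => by
    rw [hφ]; simp [φ]
  have : Algebra.FiniteType (Polynomial ℂ) Q :=
    Algebra.FiniteType.of_restrictScalars_finiteType ℂ _ _
  have : Algebra.FinitePresentation (Polynomial ℂ) Q :=
    Algebra.FinitePresentation.of_finiteType.1 inferInstance
  have : Module.IsTorsionFree (Polynomial ℂ) Q := inferInstance
  have : Module.Flat (Polynomial ℂ) Q := inferInstance
  have hopen := PrimeSpectrum.isOpenMap_comap_of_hasGoingDown_of_finitePresentation
    (R := Polynomial ℂ) (S := Q) _ (PrimeSpectrum.isOpen_basicOpen (a := h))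
  have hne : (⟨⊥, Ideal.isPrime_bot⟩ : PrimeSpectrum Q) ∈ PrimeSpectrum.basicOpen h := by
    simpa using hh
  obtain ⟨_, ⟨_, ⟨f, rfl⟩, rfl⟩, hmem, hsub⟩ := PrimeSpectrum.isBasis_basic_opens.exists_subset_of_mem_open
    (Set.mem_image_of_mem _ hne) hopen
  refine ⟨f, ?_, ?_⟩
  · rintro rfl
    simp at hmem
  · intro c hc
    have hp : (RingHom.ker (Polynomial.evalRingHom c)).IsPrime := RingHom.ker_isPrime _
    obtain ⟨q, hq, hqc⟩ := hsub (show (⟨_, hp⟩ : PrimeSpectrum (Polynomial ℂ)) ∈ _ from hc)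
    obtain ⟨e, hqe, he⟩ := exists_algHom_of_notMem_prime q.asIdeal hq
    refine ⟨e, ?_, he⟩
    have h1 : (Polynomial.X - Polynomial.C c) ∈ RingHom.ker (Polynomial.evalRingHom c) := by
      simp [RingHom.mem_ker]
    have h2 : φ (Polynomial.X - Polynomial.C c) ∈ q.asIdeal := by
      have : q.asIdeal.comap (algebraMap (Polynomial ℂ) Q) =
          RingHom.ker (Polynomial.evalRingHom c) := congrArg PrimeSpectrum.asIdeal hqc
      rw [← this] at h1
      exact h1
    have h3 := hqe h2
    simpa [RingHom.mem_ker, φ, sub_eq_zero] using h3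

/-- An isolated solution of a system of at most as many equations as the local dimension
persists under one-parameter perturbations of the equations. -/
theorem exists_algHom_perturbed {B ι : Type*} [CommRing B] [Algebra ℂ B] [Algebra.FiniteType ℂ B]
    [Fintype ι] (e : B →ₐ[ℂ] ℂ) (hD : (Fintype.card ι : ℕ∞) ≤ (RingHom.ker e).height)
    (G : ι → Polynomial B)
    (hmin : RingHom.ker e ∈
      (Ideal.span (Set.range fun s => (G s).eval 0)).minimalPrimes)
    (h : Polynomial B) (hh : e (h.eval 0) ≠ 0) :
    ∃ f : Polynomial ℂ, f ≠ 0 ∧ ∀ t, f.eval t ≠ 0 → ∃ e' : B →ₐ[ℂ] ℂ,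
      (∀ s, e' ((G s).eval (algebraMap ℂ B t)) = 0) ∧ e' (h.eval (algebraMap ℂ B t)) ≠ 0 := by
  have : IsNoetherianRing B := Algebra.FiniteType.isNoetherianRing ℂ _
  let ε : Polynomial B →+* ℂ := (e : B →+* ℂ).comp (Polynomial.evalRingHom 0)
  have hε : ∀ q, ε q = e (q.eval 0) := fun q => rfl
  have hεs : Function.Surjective ε := fun c => ⟨Polynomial.C (algebraMap ℂ B c), by simp [hε]⟩
  have hM : (RingHom.ker ε).IsMaximal := RingHom.ker_isMaximal_of_surjective ε hεs
  have hlies : (RingHom.ker ε).LiesOver (RingHom.ker e) := ⟨by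
    ext b
    simp [RingHom.mem_ker, hε, Polynomial.algebraMap_eq, Ideal.mem_comap]⟩
  have hGM : Ideal.span (Set.range G) ≤ RingHom.ker ε := by
    rw [Ideal.span_le]
    rintro _ ⟨s, rfl⟩
    exact hmin.1.2 (Ideal.subset_span ⟨s, rfl⟩)
  obtain ⟨P, hP, hPM⟩ := Ideal.exists_minimalPrimes_le hGM
  have hPp : P.IsPrime := hP.1.1
  have hPne : P ≠ RingHom.ker ε := by
    rintro rfl
    have h1 := Ideal.height_le_card_of_mem_minimalPrimes_span (Set.finite_range G) hP
    rw [Polynomial.height_eq_height_add_one (RingHom.ker e)] at h1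
    have h2 : ((Set.range G).ncard : ℕ∞) ≤ Fintype.card ι := by
      have := Set.ncard_image_le (f := G) (Set.finite_univ)
      rw [Set.image_univ, Set.ncard_univ, Nat.card_eq_fintype_card] at this
      exact_mod_cast this
    have h3 : (Fintype.card ι : ℕ∞) + 1 ≤ Fintype.card ι :=
      (add_le_add_left hD 1).trans (h1.trans h2)
    have h4 : Fintype.card ι + 1 ≤ Fintype.card ι := by exact_mod_cast h3
    omega
  have hdec : ∀ q : Polynomial B, q = Polynomial.X * q.divX + Polynomial.C (q.eval 0) := fun q => by
    rw [← Polynomial.coeff_zero_eq_eval_zero, Polynomial.X_mul_divX_add]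
  have hX : Polynomial.X ∉ P := by
    intro hX
    have hC : ∀ q ∈ P, q.eval 0 ∈ P.comap Polynomial.C := fun q hq => by
      rw [Ideal.mem_comap]
      have := P.sub_mem hq (P.mul_mem_right q.divX hX)
      rwa [sub_eq_iff_eq_add'.2 (hdec q)] at this
    have hle : P.comap Polynomial.C ≤ RingHom.ker e := fun b hb => by
      have := hPM hb
      simpa [RingHom.mem_ker, hε] using this
    have hge : RingHom.ker e ≤ P.comap Polynomial.C := by
      refine hmin.2 ⟨inferInstance, ?_⟩ hle
      rw [Ideal.span_le]
      rintro _ ⟨s, rfl⟩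
      exact hC _ (hP.1.2 (Ideal.subset_span ⟨s, rfl⟩))
    refine hPne (le_antisymm hPM fun q hq => ?_)
    rw [hdec q]
    exact P.add_mem (P.mul_mem_right _ hX) (hge hq)
  have hXc : ∀ c : ℂ, Polynomial.X - Polynomial.C (algebraMap ℂ B c) ∉ P := by
    intro c hc
    have h1 := hPM hc
    have h2 : c = 0 := by simpa [RingHom.mem_ker, hε] using h1
    subst h2
    exact hX (by simpa using hc)
  obtain ⟨f, hf0, hf⟩ := exists_algHom_over_line (Q := Polynomial B ⧸ P)
    (Ideal.Quotient.mk P Polynomial.X) (Ideal.Quotient.mk P h)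
    (fun h0 => hh (hPM (Ideal.Quotient.eq_zero_iff_mem.1 h0)))
    (fun c h0 => hXc c ((Ideal.Quotient.eq.1 (h0.trans rfl))))
  refine ⟨f, hf0, fun t ht => ?_⟩
  obtain ⟨E, hEX, hEh⟩ := hf t ht
  let e' : B →ₐ[ℂ] ℂ := (E.comp (Ideal.Quotient.mkₐ ℂ P)).comp Polynomial.CAlgHom
  have key : ∀ q : Polynomial B, e' (q.eval (algebraMap ℂ B t)) = E (Ideal.Quotient.mk P q) := by
    intro q
    have : (e' : B →+* ℂ).comp (Polynomial.evalRingHom (algebraMap ℂ B t)) =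
        (E : _ →+* ℂ).comp (Ideal.Quotient.mk P) := by
      ext b
      · simp [e']
      · simp [hEX]
    exact DFunLike.congr_fun this q
  refine ⟨e', fun s => ?_, ?_⟩
  · rw [key, Ideal.Quotient.eq_zero_iff_mem.2 (hP.1.2 (Ideal.subset_span ⟨s, rfl⟩)), map_zero]
  · rw [key]; exact hEh

/-- Simultaneous persistence of finitely many isolated solutions, keeping given open
conditions and separation conditions. -/
theorem exists_points_perturbed {A ι : Type} [CommRing A] [Algebra ℂ A] [Algebra.FiniteType ℂ A]
    [Fintype ι] {N : ℕ} (ev : Fin N → A →ₐ[ℂ] ℂ)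
    (hD : ∀ j, (Fintype.card ι : ℕ∞) ≤ (RingHom.ker (ev j)).height)
    (G : Fin N → ι → Polynomial A)
    (hmin : ∀ j, RingHom.ker (ev j) ∈
      (Ideal.span (Set.range fun s => (G j s).eval 0)).minimalPrimes)
    (h : Fin N → Polynomial A) (hh : ∀ j, ev j ((h j).eval 0) ≠ 0)
    (a : Fin N → Fin N → A) (ha : ∀ i j, i ≠ j → ev i (a i j) ≠ ev j (a i j)) :
    ∃ f : Polynomial ℂ, f ≠ 0 ∧ ∀ t, f.eval t ≠ 0 → ∃ ev' : Fin N → A →ₐ[ℂ] ℂ,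
      (∀ j s, ev' j ((G j s).eval (algebraMap ℂ A t)) = 0) ∧
      (∀ j, ev' j ((h j).eval (algebraMap ℂ A t)) ≠ 0) ∧
      ∀ i j, i ≠ j → ev' i (a i j) ≠ ev' j (a i j) := by
  obtain ⟨B, _, _, _, φ, e, he, hker, hht⟩ := exists_pi_point ev hD
  have he' : ∀ j x, e (φ j x) = ev j x := fun j x => by rw [← he j]; rfl
  have hmap : ∀ (j : Fin N) (q : Polynomial A) (t : ℂ),
      (q.map (φ j : A →+* B)).eval (algebraMap ℂ B t) = φ j (q.eval (algebraMap ℂ A t)) := by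
    intro j q t
    rw [← (φ j).commutes t]
    exact Polynomial.eval_map_apply (f := (φ j : A →+* B)) _
  have hmap0 : ∀ (j : Fin N) (q : Polynomial A),
      (q.map (φ j : A →+* B)).eval 0 = φ j (q.eval 0) := by
    intro j q
    simpa only [map_zero] using hmap j q 0
  let G' : Fin N × ι → Polynomial B := fun q => (G q.1 q.2).map (φ q.1 : A →+* B)
  let h' : Polynomial B := (∏ j, (h j).map (φ j : A →+* B)) *
    ∏ q : Fin N × Fin N, if q.1 = q.2 then 1 else
      Polynomial.C (φ q.1 (a q.1 q.2) - φ q.2 (a q.1 q.2))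
  have hsep : ∀ (E : B →ₐ[ℂ] ℂ) (t : ℂ), E (h'.eval (algebraMap ℂ B t)) =
      (∏ j, E (φ j ((h j).eval (algebraMap ℂ A t)))) *
      ∏ q : Fin N × Fin N, if q.1 = q.2 then 1 else
        (E (φ q.1 (a q.1 q.2)) - E (φ q.2 (a q.1 q.2))) := by
    intro E t
    simp only [h', Polynomial.eval_mul, Polynomial.eval_prod, hmap, map_mul, map_prod]
    congr 1
    refine Finset.prod_congr rfl fun q _ => ?_
    split_ifs <;> simp
  have hmin' : RingHom.ker e ∈
      (Ideal.span (Set.range fun s => (G' s).eval 0)).minimalPrimes := by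
    refine ⟨⟨inferInstance, ?_⟩, ?_⟩
    · rw [Ideal.span_le]
      rintro _ ⟨⟨j, s⟩, rfl⟩
      have : ev j ((G j s).eval 0) = 0 := (hmin j).1.2 (Ideal.subset_span ⟨s, rfl⟩)
      simpa [RingHom.mem_ker, G', hmap0, he'] using this
    · rintro P ⟨hP, hPs⟩ hPe
      refine hker.trans (iSup_le fun j => Ideal.map_le_iff_le_comap.2 ?_)
      refine (hmin j).2 ⟨Ideal.comap_isPrime _ _, ?_⟩ ?_
      · rw [Ideal.span_le]
        rintro _ ⟨s, rfl⟩
        have := hPs (Ideal.subset_span ⟨(j, s), rfl⟩)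
        simp only [G', hmap0] at this
        exact this
      · intro x hx
        have : e (φ j x) = 0 := hPe hx
        rwa [he'] at this
  have hh' : e (h'.eval 0) ≠ 0 := by
    have := hsep e 0
    rw [map_zero, map_zero] at this
    rw [this, mul_ne_zero_iff, Finset.prod_ne_zero_iff, Finset.prod_ne_zero_iff]
    refine ⟨fun j _ => by rw [he']; exact hh j, fun q _ => ?_⟩
    split_ifs with hq
    · exact one_ne_zero
    · rw [he', he', sub_ne_zero]
      exact ha _ _ hq
  obtain ⟨f, hf0, hf⟩ := exists_algHom_perturbed e (by simpa using hht) G' hmin' h' hh'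
  refine ⟨f, hf0, fun t ht => ?_⟩
  obtain ⟨E, hE1, hE2⟩ := hf t ht
  rw [hsep, mul_ne_zero_iff, Finset.prod_ne_zero_iff, Finset.prod_ne_zero_iff] at hE2
  refine ⟨fun j => E.comp (φ j), fun j s => ?_, fun j => hE2.1 j (Finset.mem_univ _),
    fun i j hij => ?_⟩
  · have := hE1 (j, s)
    simp only [G', hmap] at this
    exact this
  · have := hE2.2 (i, j) (Finset.mem_univ _)
    simpa [hij, sub_eq_zero] using this

/-- A point of the zero locus of `P`, as a homomorphism from the quotient ring. -/
noncomputable def evalQuot {σ : Type} {P : Ideal (MvPolynomial σ ℂ)} {x : σ → ℂ}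
    (hx : x ∈ zeroLocus ℂ P) : (MvPolynomial σ ℂ ⧸ P) →ₐ[ℂ] ℂ :=
  Ideal.Quotient.liftₐ P (aeval x) hx

@[simp]
theorem evalQuot_mk {σ : Type} {P : Ideal (MvPolynomial σ ℂ)} {x : σ → ℂ}
    (hx : x ∈ zeroLocus ℂ P) (q : MvPolynomial σ ℂ) :
    evalQuot hx (Ideal.Quotient.mk P q) = aeval x q := rfl

theorem exists_aeval_eq_zero_of_ringKrullDim_lt {A : Type} [CommRing A] [IsDomain A] [Algebra ℂ A]
    [Algebra.FiniteType ℂ A] {d : ℕ} (hd : ringKrullDim A < d) (g : Fin d → A) :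
    ∃ f : MvPolynomial (Fin d) ℂ, f ≠ 0 ∧ aeval g f = 0 := by
  by_contra hcon
  push Not at hcon
  have : AlgebraicIndependent ℂ g := (injective_iff_map_eq_zero _).2 fun f hf => by
    by_contra hf0
    exact hcon f hf0 hf
  exact absurd this.le_ringKrullDim (not_le.2 hd)

theorem exists_eval₂_aeval_eq_zero {A : Type} [CommRing A] [IsDomain A] [Algebra ℂ A]
    [Algebra.FiniteType ℂ A] {d : ℕ} (hd : ringKrullDim A ≤ d) (g : Fin d → A) (x : A) :
    ∃ q : Polynomial (MvPolynomial (Fin d) ℂ), q ≠ 0 ∧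
      q.eval₂ (aeval (R := ℂ) g : _ →+* A) x = 0 := by
  have hd' : ringKrullDim A < (d + 1 : ℕ) := lt_of_le_of_lt hd (by exact_mod_cast Nat.lt_succ_self d)
  obtain ⟨F, hF0, hF⟩ := exists_aeval_eq_zero_of_ringKrullDim_lt hd' (Fin.cons x g)
  refine ⟨finSuccEquiv ℂ d F, by simpa using hF0, ?_⟩
  have : (Polynomial.eval₂RingHom (aeval (R := ℂ) g : _ →+* A) x).comp
      (finSuccEquiv ℂ d : _ →+* Polynomial (MvPolynomial (Fin d) ℂ)) =
      (aeval (R := ℂ) (Fin.cons x g : Fin (d + 1) → A) : MvPolynomial (Fin (d + 1)) ℂ →+* A) := by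
    refine MvPolynomial.ringHom_ext (fun c => ?_) (fun i => ?_)
    · simp [finSuccEquiv_apply]
    · refine Fin.cases ?_ (fun i => ?_) i
      · simp [finSuccEquiv_X_zero]
      · simp [finSuccEquiv_X_succ]
  have h2 := DFunLike.congr_fun this F
  exact h2.trans hF

theorem exists_eval₂_aeval_eq_zero_coeff {A : Type} [CommRing A] [IsDomain A] [Algebra ℂ A]
    [Algebra.FiniteType ℂ A] {d : ℕ} (hd : ringKrullDim A ≤ d) (g : Fin d → A) {x : A}
    (hx : x ≠ 0) :
    ∃ q : Polynomial (MvPolynomial (Fin d) ℂ), q.coeff 0 ≠ 0 ∧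
      q.eval₂ (aeval (R := ℂ) g : _ →+* A) x = 0 := by
  obtain ⟨q, hq0, hq⟩ := exists_eval₂_aeval_eq_zero hd g x
  let : Algebra (MvPolynomial (Fin d) ℂ) A := (aeval (R := ℂ) g : _ →+* A).toAlgebra
  have halg : IsAlgebraic (MvPolynomial (Fin d) ℂ) x := ⟨q, hq0, hq⟩
  exact halg.exists_nonzero_coeff_and_aeval_eq_zero (mem_nonZeroDivisors_of_ne_zero hx)

theorem AlgHom.comp_aeval_eq_aeval {A : Type} [CommRing A] [Algebra ℂ A] {d : ℕ} {g : Fin d → A}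
    (e : A →ₐ[ℂ] ℂ) {c : Fin d → ℂ} (h : ∀ s, e (g s) = c s) (f : MvPolynomial (Fin d) ℂ) :
    e (aeval g f) = eval c f := by
  have : (fun s => e (g s)) = c := funext h
  rw [← this, ← AlgHom.comp_apply, comp_aeval]
  rfl

theorem AlgHom.apply_eval₂_aeval {A : Type} [CommRing A] [Algebra ℂ A] {d : ℕ} {g : Fin d → A}
    (e : A →ₐ[ℂ] ℂ) {c : Fin d → ℂ} (h : ∀ s, e (g s) = c s)
    (q : Polynomial (MvPolynomial (Fin d) ℂ)) (x : A) :
    e (q.eval₂ (aeval (R := ℂ) g : _ →+* A) x) = q.eval₂ (eval c) (e x) := by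
  have h1 : (e : A →+* ℂ).comp (aeval (R := ℂ) g : _ →+* A) = eval c :=
    RingHom.ext fun f => e.comp_aeval_eq_aeval h f
  rw [← h1]
  exact Polynomial.hom_eval₂ q _ (e : A →+* ℂ) x

section Prime

variable {σ : Type} [Finite σ] {d : ℕ} (P : Ideal (MvPolynomial σ ℂ)) [P.IsPrime]
  (g : Fin d → MvPolynomial σ ℂ)

theorem generic_fiber_finite (hd : ringKrullDim (MvPolynomial σ ℂ ⧸ P) ≤ d) :
    ∃ f : MvPolynomial (Fin d) ℂ, f ≠ 0 ∧ ∀ c, eval c f ≠ 0 →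
      {x | x ∈ zeroLocus ℂ P ∧ ∀ s, aeval x (g s) = c s}.Finite := by
  have := Fintype.ofFinite σ
  choose q hq0 hq using fun i : σ =>
    exists_eval₂_aeval_eq_zero hd (fun s => Ideal.Quotient.mk P (g s)) (Ideal.Quotient.mk P (X i))
  refine ⟨∏ i, (q i).leadingCoeff, Finset.prod_ne_zero_iff.2 fun i _ => by simpa using hq0 i,
    fun c hc => ?_⟩
  rw [map_prod, Finset.prod_ne_zero_iff] at hc
  refine (Set.Finite.pi' (t := fun i => {z | ((q i).map (eval c)).IsRoot z}) fun i => ?_).subset ?_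
  · refine Polynomial.finite_setOfPred_isRoot fun h0 => hc i (Finset.mem_univ _) ?_
    have := congrArg (fun r => Polynomial.coeff r (q i).natDegree) h0
    simpa using this
  · rintro x ⟨hx, hxc⟩ i
    have h1 := (evalQuot hx).apply_eval₂_aeval (c := c)
      (g := fun s => Ideal.Quotient.mk P (g s)) hxc (q i) (Ideal.Quotient.mk P (X i))
    rw [hq, map_zero] at h1
    simp only [evalQuot_mk, aeval_X] at h1
    rw [Set.mem_ofPred_eq, Polynomial.IsRoot, Polynomial.eval_map]
    exact h1.symm

theorem generic_fiber_ne_zero (hd : ringKrullDim (MvPolynomial σ ℂ ⧸ P) ≤ d)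
    {h : MvPolynomial σ ℂ} (hh : h ∉ P) :
    ∃ f : MvPolynomial (Fin d) ℂ, f ≠ 0 ∧ ∀ c, eval c f ≠ 0 →
      ∀ x ∈ zeroLocus ℂ P, (∀ s, aeval x (g s) = c s) → aeval x h ≠ 0 := by
  obtain ⟨q, hq0, hq⟩ := exists_eval₂_aeval_eq_zero_coeff hd (fun s => Ideal.Quotient.mk P (g s))
    (x := Ideal.Quotient.mk P h) (fun h0 => hh (Ideal.Quotient.eq_zero_iff_mem.1 h0))
  refine ⟨_, hq0, fun c hc x hx hxc h0 => hc ?_⟩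
  have h1 := (evalQuot hx).apply_eval₂_aeval (c := c)
      (g := fun s => Ideal.Quotient.mk P (g s)) hxc q (Ideal.Quotient.mk P h)
  rw [hq, map_zero, evalQuot_mk, h0, Polynomial.eval₂_at_zero] at h1
  exact h1.symm

theorem generic_fiber_empty (hd : ringKrullDim (MvPolynomial σ ℂ ⧸ P) < d) :
    ∃ f : MvPolynomial (Fin d) ℂ, f ≠ 0 ∧ ∀ c, eval c f ≠ 0 →
      ∀ x ∈ zeroLocus ℂ P, ¬ ∀ s, aeval x (g s) = c s := by
  obtain ⟨f, hf0, hf⟩ := exists_aeval_eq_zero_of_ringKrullDim_lt hd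
    (fun s => Ideal.Quotient.mk P (g s))
  refine ⟨f, hf0, fun c hc x hx hxc => hc ?_⟩
  rw [← (evalQuot hx).comp_aeval_eq_aeval (g := fun s => Ideal.Quotient.mk P (g s)) hxc, hf,
    map_zero]

end Prime

theorem exists_minimalPrimes_mem_zeroLocus {σ : Type} {I : Ideal (MvPolynomial σ ℂ)} {x : σ → ℂ}
    (hx : x ∈ zeroLocus ℂ I) : ∃ P ∈ I.minimalPrimes, x ∈ zeroLocus ℂ P := by
  have h : I ≤ vanishingIdeal ℂ {x} := le_zeroLocus_iff_le_vanishingIdeal.1 (by simpa using hx)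
  obtain ⟨P, hP, hPx⟩ := Ideal.exists_minimalPrimes_le h
  exact ⟨P, hP, fun p hp => hPx hp x rfl⟩

/-- A property holding generically over each irreducible component holds generically. -/
theorem exists_generic_of_minimalPrimes {σ : Type} [Finite σ] {d : ℕ}
    (I : Ideal (MvPolynomial σ ℂ)) {R : (Fin d → ℂ) → (σ → ℂ) → Prop}
    (h : ∀ P ∈ I.minimalPrimes, ∃ f : MvPolynomial (Fin d) ℂ, f ≠ 0 ∧ ∀ c, eval c f ≠ 0 →
      ∀ x ∈ zeroLocus ℂ P, R c x) :
    ∃ f : MvPolynomial (Fin d) ℂ, f ≠ 0 ∧ ∀ c, eval c f ≠ 0 → ∀ x ∈ zeroLocus ℂ I, R c x := by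
  choose! f hf0 hf using h
  have hfin : I.minimalPrimes.Finite := Ideal.finite_minimalPrimes_of_isNoetherianRing _ I
  refine ⟨∏ P ∈ hfin.toFinset, f P, Finset.prod_ne_zero_iff.2 fun P hP => hf0 P (by simpa using hP),
    fun c hc x hx => ?_⟩
  rw [map_prod, Finset.prod_ne_zero_iff] at hc
  obtain ⟨P, hP, hxP⟩ := exists_minimalPrimes_mem_zeroLocus hx
  exact hf P hP c (hc P (by simpa using hP)) x hxP

theorem exists_generic_fiber_finite {σ : Type} [Finite σ] {d : ℕ} (I : Ideal (MvPolynomial σ ℂ))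
    (hI : ∀ P ∈ I.minimalPrimes, ringKrullDim (MvPolynomial σ ℂ ⧸ P) ≤ d)
    (g : Fin d → MvPolynomial σ ℂ) :
    ∃ f : MvPolynomial (Fin d) ℂ, f ≠ 0 ∧ ∀ c, eval c f ≠ 0 →
      {x | x ∈ zeroLocus ℂ I ∧ ∀ s, aeval x (g s) = c s}.Finite := by
  have hfin : I.minimalPrimes.Finite := Ideal.finite_minimalPrimes_of_isNoetherianRing _ I
  obtain ⟨f, hf0, hf⟩ := exists_generic_of_minimalPrimes I
    (R := fun c x => (∀ s, aeval x (g s) = c s) → x ∈ ⋃ P ∈ {P | P ∈ I.minimalPrimes ∧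
      {x | x ∈ zeroLocus ℂ P ∧ ∀ s, aeval x (g s) = c s}.Finite},
      {x | x ∈ zeroLocus ℂ P ∧ ∀ s, aeval x (g s) = c s}) fun P hP => by
    have := hP.1.1
    obtain ⟨f, hf0, hf⟩ := generic_fiber_finite P g (hI P hP)
    exact ⟨f, hf0, fun c hc x hx hxc => Set.mem_biUnion (x := P) ⟨hP, hf c hc⟩ ⟨hx, hxc⟩⟩
  refine ⟨f, hf0, fun c hc => Set.Finite.subset (Set.Finite.biUnion
    (s := {P | P ∈ I.minimalPrimes ∧
      {x | x ∈ zeroLocus ℂ P ∧ ∀ s, aeval x (g s) = c s}.Finite}) (hfin.subset fun P hP => hP.1)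
    fun P hP => hP.2) fun x hx => hf c hc x hx.1 hx.2⟩

theorem Ideal.height_le_height_comap_of_surjective {R S : Type*} [CommRing R] [CommRing S]
    (f : R →+* S) (hf : Function.Surjective f) (m : Ideal S) [hm : m.IsPrime] :
    m.height ≤ (m.comap f).height := by
  have h : StrictMono (PrimeSpectrum.comap f) := fun I J h =>
    lt_of_le_of_ne (Ideal.comap_mono (f := f) h.le)
      fun h' => h.ne (PrimeSpectrum.comap_injective_of_surjective f hf h')
  have := Order.height_le_height_apply_of_strictMono _ h ⟨m, hm⟩
  rwa [← PrimeSpectrum.height_eq_orderHeight, ← PrimeSpectrum.height_eq_orderHeight] at this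

theorem mem_minimalPrimes_of_finite {σ : Type} [Finite σ] (I : Ideal (MvPolynomial σ ℂ))
    {y : σ → ℂ} (hy : y ∈ zeroLocus ℂ I) (δ : MvPolynomial σ ℂ) (hδ : aeval y δ ≠ 0)
    (hfin : {z | z ∈ zeroLocus ℂ I ∧ aeval z δ ≠ 0}.Finite) :
    vanishingIdeal ℂ {y} ∈ I.minimalPrimes := by
  have hIy : I ≤ vanishingIdeal ℂ {y} := le_zeroLocus_iff_le_vanishingIdeal.1 (by simpa using hy)
  refine ⟨⟨inferInstance, hIy⟩, ?_⟩
  rintro P ⟨hP, hIP⟩ hPy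
  by_cases hz : ∃ z : σ → ℂ, vanishingIdeal ℂ {z} ≤ P
  · obtain ⟨z, hz⟩ := hz
    have : (vanishingIdeal ℂ {z} : Ideal (MvPolynomial σ ℂ)).IsMaximal := inferInstance
    rw [← this.eq_of_le hP.ne_top hz] at hPy ⊢
    rw [this.eq_of_le (Ideal.IsPrime.ne_top inferInstance) hPy]
  · exfalso
    push Not at hz
    choose q hq hqP using fun z => Set.not_subset.1 (hz z)
    have hmem : δ * ∏ z ∈ hfin.toFinset, q z ∈ P := by
      rw [← IsPrime.vanishingIdeal_zeroLocus (K := ℂ) P]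
      intro z hz
      rw [map_mul, map_prod]
      by_cases h0 : aeval z δ = 0
      · rw [h0, zero_mul]
      · refine mul_eq_zero_of_right _ (Finset.prod_eq_zero (i := z) ?_ (hq z z rfl))
        rw [Set.Finite.mem_toFinset]
        exact ⟨zeroLocus_anti_mono hIP hz, h0⟩
    rcases hP.mem_or_mem hmem with h | h
    · exact hδ (hPy h y rfl)
    · obtain ⟨z, -, hz⟩ := (hP.prod_mem_iff).1 h
      exact hqP z hz

theorem ringKrullDim_quotient_add_one_le {R : Type*} [CommRing R] {P Q : Ideal R} [P.IsPrime]
    (h : P < Q) : ringKrullDim (R ⧸ Q) + 1 ≤ ringKrullDim (R ⧸ P) := by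
  obtain ⟨r, hrQ, hrP⟩ := SetLike.exists_of_lt h
  have hr : Ideal.Quotient.mk P r ∈ nonZeroDivisors (R ⧸ P) :=
    mem_nonZeroDivisors_of_ne_zero fun h0 => hrP (Ideal.Quotient.eq_zero_iff_mem.1 h0)
  refine le_trans ?_ (ringKrullDim_quotient_succ_le_of_nonZeroDivisor hr)
  gcongr
  refine ringKrullDim_le_of_surjective (Ideal.Quotient.lift (Ideal.span {Ideal.Quotient.mk P r})
    (Ideal.Quotient.factor h.le) ?_) ?_
  · intro a ha
    have : Ideal.span {Ideal.Quotient.mk P r} ≤ RingHom.ker (Ideal.Quotient.factor h.le) := by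
      rw [Ideal.span_singleton_le_iff_mem, RingHom.mem_ker, Ideal.Quotient.factor_mk]
      exact Ideal.Quotient.eq_zero_iff_mem.2 hrQ
    exact this ha
  · exact Ideal.Quotient.lift_surjective_of_surjective _ _ (Ideal.Quotient.factor_surjective h.le)

/-- Finitely many isolated points of the intersection of an affine variety of dimension at most
`d` with a linear system of polynomials are isolated by `d` members of the system. -/
theorem exists_isolating_equations {σ : Type} [Finite σ] {d N : ℕ} (I : Ideal (MvPolynomial σ ℂ))
    (hI : ∀ P ∈ I.minimalPrimes, ringKrullDim (MvPolynomial σ ℂ ⧸ P) ≤ d)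
    (Y : Submodule ℂ (MvPolynomial σ ℂ)) (x : Fin N → σ → ℂ)
    (hx : ∀ j, x j ∈ zeroLocus ℂ I) (hxY : ∀ j, ∀ g ∈ Y, aeval (x j) g = 0)
    (hfin : {z | z ∈ zeroLocus ℂ I ∧ ∀ g ∈ Y, aeval z g = 0}.Finite) :
    ∃ g : Fin d → MvPolynomial σ ℂ, (∀ s, g s ∈ Y) ∧
      ∀ j, vanishingIdeal ℂ {x j} ∈ (I ⊔ Ideal.span (Set.range g)).minimalPrimes := by
  have hcontain : ∀ {k : ℕ} {g : Fin k → MvPolynomial σ ℂ}, (∀ s, g s ∈ Y) → ∀ j,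
      I ⊔ Ideal.span (Set.range g) ≤ vanishingIdeal ℂ {x j} := by
    intro k g hg j
    refine sup_le (le_zeroLocus_iff_le_vanishingIdeal.1 (by simpa using hx j)) ?_
    rw [Ideal.span_le]
    rintro _ ⟨s, rfl⟩ _ rfl
    exact hxY j _ (hg s)
  have key : ∀ k ≤ d, ∃ g : Fin k → MvPolynomial σ ℂ, (∀ s, g s ∈ Y) ∧
      ∀ P : Ideal (MvPolynomial σ ℂ), P.IsPrime → I ⊔ Ideal.span (Set.range g) ≤ P →
        ∀ j, P ≤ vanishingIdeal ℂ {x j} →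
        P ≠ vanishingIdeal ℂ {x j} → ringKrullDim (MvPolynomial σ ℂ ⧸ P) ≤ (d - k : ℕ) := by
    intro k
    induction k with
    | zero =>
      refine fun _ => ⟨Fin.elim0, fun s => s.elim0, fun P hP hIP j _ _ => ?_⟩
      obtain ⟨Q, hQ, hQP⟩ := Ideal.exists_minimalPrimes_le (le_sup_left.trans hIP)
      exact (ringKrullDim_le_of_surjective _ (Ideal.Quotient.factor_surjective hQP)).trans (hI Q hQ)
    | succ k ih =>
      intro hk
      obtain ⟨g, hgY, hg⟩ := ih (by omega)
      let J := I ⊔ Ideal.span (Set.range g)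
      have hJfin : J.minimalPrimes.Finite := Ideal.finite_minimalPrimes_of_isNoetherianRing _ J
      have : Finite {Q // Q ∈ J.minimalPrimes ∧ ¬ (∀ y ∈ Y, y ∈ Q)} :=
        (hJfin.subset fun Q hQ => hQ.1 : {Q | Q ∈ J.minimalPrimes ∧ ¬ (∀ y ∈ Y, y ∈ Q)}.Finite)
      obtain ⟨y, hy⟩ : ∃ y : Y, ∀ Q ∈ J.minimalPrimes, ¬ (∀ y ∈ Y, y ∈ Q) →
          (y : MvPolynomial σ ℂ) ∉ Q := by
        by_contra hcon
        push Not at hcon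
        obtain ⟨⟨Q, hQ, hYQ⟩, htop⟩ := Subspace.exists_eq_top_of_iUnion_eq_univ (k := ℂ) (E := Y)
          (p := fun Q : {Q // Q ∈ J.minimalPrimes ∧ ¬ (∀ y ∈ Y, y ∈ Q)} =>
            (Q.1.restrictScalars ℂ).comap Y.subtype) (by
            refine Set.eq_univ_of_forall fun y => ?_
            obtain ⟨Q, hQ, ⟨z, hz, hzQ⟩, hyQ⟩ := hcon y
            exact Set.mem_iUnion.2 ⟨⟨Q, hQ, fun h => hzQ (h z hz)⟩, hyQ⟩)
        refine hYQ fun z hz => ?_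
        have : (⟨z, hz⟩ : Y) ∈ (Q.restrictScalars ℂ).comap Y.subtype := htop ▸ Submodule.mem_top
        exact this
      refine ⟨Fin.cons y g, fun s => Fin.cases y.2 hgY s, fun P hP hIP j hPj hPne => ?_⟩
      have hrange : Set.range (Fin.cons (y : MvPolynomial σ ℂ) g : Fin (k + 1) → _) =
        insert (y : MvPolynomial σ ℂ) (Set.range g) := Fin.range_cons _ _
      rw [hrange] at hIP
      have hJP : J ≤ P := (sup_le_sup_left (Ideal.span_mono (Set.subset_insert _ _)) _).trans hIP
      have hyP : (y : MvPolynomial σ ℂ) ∈ P :=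
        hIP (Ideal.mem_sup_right (Ideal.subset_span (Set.mem_insert _ _)))
      obtain ⟨Q, hQ, hQP⟩ := Ideal.exists_minimalPrimes_le hJP
      have hQp : Q.IsPrime := hQ.1.1
      have hQx : x j ∈ zeroLocus ℂ Q := fun p hp => hPj (hQP hp) _ rfl
      have hQne : Q ≠ vanishingIdeal ℂ {x j} := by
        rintro rfl
        exact hPne (le_antisymm hPj hQP)
      have hYQ : ¬ (∀ y ∈ Y, y ∈ Q) := by
        intro hYQ
        refine hQne ?_
        have := mem_minimalPrimes_of_finite Q hQx 1 (by simp) (hfin.subset fun z hz =>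
          ⟨fun p hp => hz.1 p (hQ.1.2 (Ideal.mem_sup_left hp)), fun g hg => hz.1 g (hYQ g hg)⟩)
        rw [Ideal.minimalPrimes_eq_subsingleton_self] at this
        exact this.symm
      have hlt : Q < P := lt_of_le_of_ne hQP (by rintro rfl; exact hy Q hQ hYQ hyP)
      have h1 := (ringKrullDim_quotient_add_one_le hlt).trans
        (hg Q hQp hQ.1.2 j (hQP.trans hPj) hQne)
      have h2 : d - k = (d - (k + 1)) + 1 := by omega
      rw [h2] at h1
      have h3 := ENat.WithBot.add_one_le_natCast_iff.1 h1
      push_cast at h3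
      exact ENat.WithBot.lt_add_one_iff.1 h3
  obtain ⟨g, hgY, hg⟩ := key d le_rfl
  refine ⟨g, hgY, fun j => ⟨⟨inferInstance, hcontain hgY j⟩, ?_⟩⟩
  rintro P ⟨hP, hIP⟩ hPj
  by_contra hne
  have hlt : P < vanishingIdeal ℂ {x j} := lt_of_le_not_ge hPj hne
  have h1 := (ringKrullDim_quotient_add_one_le hlt).trans (hg P hP hIP j hPj hlt.ne)
  have : Nontrivial (MvPolynomial σ ℂ ⧸ (vanishingIdeal ℂ {x j} : Ideal (MvPolynomial σ ℂ))) :=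
    Ideal.Quotient.nontrivial_iff.2 (Ideal.IsPrime.ne_top inferInstance)
  rw [Nat.sub_self, Nat.cast_zero, ENat.WithBot.add_one_le_zero_iff] at h1
  have h2 := ringKrullDim_nonneg_of_nontrivial
    (R := MvPolynomial σ ℂ ⧸ (vanishingIdeal ℂ {x j} : Ideal (MvPolynomial σ ℂ)))
  rw [h1] at h2
  exact absurd h2 (by simp)

theorem MvPolynomial.exists_eval_ne_zero {σ : Type*} {f : MvPolynomial σ ℂ} (hf : f ≠ 0) :
    ∃ c, eval c f ≠ 0 := by
  by_contra h
  push Not at h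
  exact hf (MvPolynomial.funext fun c => by rw [h, map_zero])

theorem Polynomial.exists_eval_ne_zero {f : Polynomial ℂ} (hf : f ≠ 0) :
    ∃ c, f.eval c ≠ 0 := by
  by_contra h
  push Not at h
  exact hf (Polynomial.funext fun c => by rw [h, Polynomial.eval_zero])

/-- The restriction of a polynomial to the parametrized line `t ↦ c + t v`. -/
noncomputable def MvPolynomial.toLine {σ : Type*} (c v : σ → ℂ) (f : MvPolynomial σ ℂ) :
    Polynomial ℂ :=
  aeval (fun s => Polynomial.C (c s) + Polynomial.C (v s) * Polynomial.X) f

theorem MvPolynomial.eval_toLine {σ : Type*} (c v : σ → ℂ) (f : MvPolynomial σ ℂ) (t : ℂ) :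
    (f.toLine c v).eval t = eval (c + t • v) f := by
  have h : (Polynomial.aeval t).comp
      (aeval (R := ℂ) fun s => Polynomial.C (c s) + Polynomial.C (v s) * Polynomial.X) =
      aeval (c + t • v) := by
    ext s
    simp only [AlgHom.comp_apply, aeval_X, map_add, map_mul, Polynomial.aeval_C,
      Polynomial.aeval_X, Pi.add_apply, Pi.smul_apply, smul_eq_mul, Algebra.algebraMap_self,
      RingHom.id_apply]
    ring
  exact DFunLike.congr_fun h f

theorem ker_evalQuot_le_height {σ : Type} [Finite σ] {d : ℕ} {I : Ideal (MvPolynomial σ ℂ)}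
    (hI : ∀ P ∈ I.minimalPrimes, ringKrullDim (MvPolynomial σ ℂ ⧸ P) = d) {x : σ → ℂ}
    (hx : x ∈ zeroLocus ℂ I) : (d : ℕ∞) ≤ (RingHom.ker (evalQuot hx)).height := by
  obtain ⟨P, hP, hxP⟩ := exists_minimalPrimes_mem_zeroLocus hx
  have hPp : P.IsPrime := hP.1.1
  obtain ⟨s, -, -, -, hs, hht⟩ := exists_noether_normalization_height ℂ (MvPolynomial σ ℂ ⧸ P)
  have hsd : s = d := by
    rw [hI P hP] at hs
    exact_mod_cast hs.symm
  subst hsd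
  have h1 := Ideal.height_le_height_comap_of_surjective (Ideal.Quotient.factor hP.1.2)
    (Ideal.Quotient.factor_surjective hP.1.2) (RingHom.ker (evalQuot hxP))
  refine ((hht _ inferInstance).trans h1).trans (Ideal.height_mono fun y hy => ?_)
  obtain ⟨y, rfl⟩ := Ideal.Quotient.mk_surjective y
  exact hy

theorem exists_linear_form_of_notMem {n : ℕ} {E : AffineSubspace ℂ (Fin n → ℂ)} {e z : Fin n → ℂ}
    (he : e ∈ E) (hz : z ∉ E) :
    ∃ (u : Fin n → ℂ) (c : ℂ), (∀ y ∈ E, ∑ l, u l * y l = c) ∧ ∑ l, u l * z l ≠ c := by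
  have h1 : z - e ∉ E.direction := fun h => hz (by
    have := AffineSubspace.vadd_mem_of_mem_direction h he
    simpa using this)
  obtain ⟨f, hf, hle⟩ := Submodule.exists_le_ker_of_notMem h1
  have hfu : ∀ y, ∑ l, f (Pi.single l 1) * y l = f y := by
    intro y
    conv_rhs => rw [LinearMap.pi_apply_eq_sum_univ f y]
    refine Finset.sum_congr rfl fun l _ => ?_
    rw [smul_eq_mul, mul_comm]
    congr 2
    ext i
    simp [Pi.single_apply, eq_comm]
  refine ⟨fun l => f (Pi.single l 1), f e, fun y hy => ?_, ?_⟩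
  · rw [hfu, ← sub_eq_zero, ← map_sub]
    exact hle (AffineSubspace.vsub_mem_direction hy he)
  · rw [hfu, ← sub_ne_zero, ← map_sub]
    exact hf

/-- The linear form with coefficients `u`. -/
noncomputable def linForm {σ : Type} [Fintype σ] (u : σ → ℂ) : MvPolynomial σ ℂ :=
  ∑ l, C (u l) * X l

@[simp]
theorem eval_linForm {σ : Type} [Fintype σ] (u x : σ → ℂ) :
    eval x (linForm u) = ∑ l, u l * x l := by
  simp [linForm]

/-- If an affine variety of pure dimension `d` meets some affine subspace in finitely many
points, then it meets a generic translate of a suitable linear subspace of codimension `d`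
in at least as many points. -/
theorem exists_generic_slice {n d N : ℕ} (I : Ideal (MvPolynomial (Fin n) ℂ))
    (hI : ∀ P ∈ I.minimalPrimes, ringKrullDim (MvPolynomial (Fin n) ℂ ⧸ P) = d)
    (E : AffineSubspace ℂ (Fin n → ℂ)) (hfin : (zeroLocus ℂ I ∩ (E : Set (Fin n → ℂ))).Finite)
    (x : Fin N → Fin n → ℂ) (hxinj : Function.Injective x) (hxI : ∀ j, x j ∈ zeroLocus ℂ I)
    (hxE : ∀ j, x j ∈ E) (R : Matrix (Fin d) (Fin n) ℂ → (Fin d → ℂ) → Prop)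
    (hR : ∀ M, ∃ f : MvPolynomial (Fin d) ℂ, f ≠ 0 ∧ ∀ c, eval c f ≠ 0 → R M c) :
    ∃ M c, R M c ∧ ∃ y : Fin N → Fin n → ℂ, Function.Injective y ∧
      ∀ j, y j ∈ zeroLocus ℂ I ∧ ∀ s, ∑ l, M s l * y j l = c s := by
  rcases Nat.eq_zero_or_pos N with rfl | hN
  · obtain ⟨f, hf0, hf⟩ := hR 0
    obtain ⟨c, hc⟩ := MvPolynomial.exists_eval_ne_zero hf0
    exact ⟨0, c, hf c hc, Fin.elim0, fun i => i.elim0, fun i => i.elim0⟩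
  let Y : Submodule ℂ (MvPolynomial (Fin n) ℂ) :=
    { carrier := {q | ∃ u c, q = linForm u - C c ∧ ∀ y ∈ E, ∑ l, u l * y l = c}
      add_mem' := by
        rintro _ _ ⟨u, c, rfl, hu⟩ ⟨u', c', rfl, hu'⟩
        refine ⟨u + u', c + c', ?_, fun y hy => ?_⟩
        · simp only [linForm, Pi.add_apply, map_add, add_mul, Finset.sum_add_distrib]
          ring
        · simp only [Pi.add_apply, add_mul, Finset.sum_add_distrib, hu y hy, hu' y hy]
      zero_mem' := ⟨0, 0, by simp [linForm], by simp⟩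
      smul_mem' := by
        rintro k _ ⟨u, c, rfl, hu⟩
        refine ⟨k • u, k • c, ?_, fun y hy => ?_⟩
        · simp only [linForm, Pi.smul_apply, smul_eq_mul, map_mul, mul_assoc, ← Finset.mul_sum,
            smul_eq_C_mul]
          ring
        · simp only [Pi.smul_apply, smul_eq_mul, mul_assoc, ← Finset.mul_sum, hu y hy] }
  obtain ⟨g, hgY, hgmin⟩ := exists_isolating_equations I (fun P hP => (hI P hP).le) Y x hxI
    (by
      rintro j _ ⟨u, c, rfl, hu⟩
      simp [hu _ (hxE j)])
    (hfin.subset fun z hz => ⟨hz.1, by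
      by_contra hzE
      obtain ⟨u, c, hu, huz⟩ := exists_linear_form_of_notMem (hxE ⟨0, hN⟩) hzE
      have := hz.2 _ ⟨u, c, rfl, hu⟩
      exact huz (by simpa [sub_eq_zero] using this)⟩)
  choose M c₁ hg hME using hgY
  obtain ⟨f, hf0, hf⟩ := hR M
  obtain ⟨c₂, hc₂⟩ := MvPolynomial.exists_eval_ne_zero hf0
  let A := MvPolynomial (Fin n) ℂ ⧸ I
  let mk := Ideal.Quotient.mkₐ ℂ I
  have hsep : ∀ i j, ∃ q : MvPolynomial (Fin n) ℂ, i ≠ j → eval (x i) q ≠ eval (x j) q := by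
    intro i j
    by_cases hij : i = j
    · exact ⟨0, fun h => absurd hij h⟩
    · obtain ⟨l, hl⟩ := Function.ne_iff.1 (hxinj.ne hij)
      exact ⟨X l, fun _ => by simpa using hl⟩
  choose q hq using hsep
  have hG0 : ∀ s, (Polynomial.C (mk (g s)) - Polynomial.C (algebraMap ℂ A ((c₂ - c₁) s)) *
      Polynomial.X : Polynomial A).eval 0 = mk (g s) := by simp
  obtain ⟨f₁, hf₁, hev⟩ := exists_points_perturbed (A := A) (ι := Fin d)
    (fun j => evalQuot (hxI j))
    (fun j => by simpa using ker_evalQuot_le_height hI (hxI j))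
    (fun _ s => Polynomial.C (mk (g s)) - Polynomial.C (algebraMap ℂ A ((c₂ - c₁) s)) *
      Polynomial.X)
    (fun j => by
      simp only [hG0]
      have h1 : Ideal.span (Set.range fun s => mk (g s)) =
          (Ideal.span (Set.range g)).map mk := by
        rw [Ideal.map_span, ← Set.range_comp]; rfl
      have hsurj : Function.Surjective (mk : MvPolynomial (Fin n) ℂ →+* A) :=
        Ideal.Quotient.mk_surjective
      have h2 : ((Ideal.span (Set.range g)).map mk).comap (mk : MvPolynomial (Fin n) ℂ →+* A) =
          I ⊔ Ideal.span (Set.range g) := by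
        refine (Ideal.comap_map_of_surjective' (mk : MvPolynomial (Fin n) ℂ →+* A) hsurj _).trans ?_
        rw [sup_comm]
        congr 1
        exact Ideal.mk_ker
      have h3 := hgmin j
      rw [← h2] at h3
      obtain ⟨Q, hQ, hQx⟩ := Ideal.exists_minimalPrimes_comap_eq _ _ h3
      rw [h1]
      convert hQ
      refine Ideal.comap_injective_of_surjective _ hsurj ?_
      rw [hQx]
      ext r
      simp only [Ideal.mem_comap, RingHom.mem_ker, mem_vanishingIdeal_iff, Set.mem_singleton_iff,
        forall_eq]
      exact Iff.rfl)
    (fun _ => 1) (by simp) (fun i j => mk (q i j)) (fun i j hij => by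
      have := hq i j hij
      change aeval (x i) _ ≠ aeval (x j) _
      simpa using this)
  have hline : f.toLine c₁ (c₂ - c₁) ≠ 0 := fun h => hc₂ (by
    have := eval_toLine c₁ (c₂ - c₁) f 1
    rw [h] at this
    simpa using this.symm)
  obtain ⟨t, ht⟩ := Polynomial.exists_eval_ne_zero (mul_ne_zero hf₁ hline)
  rw [Polynomial.eval_mul, eval_toLine] at ht
  obtain ⟨ev', hev1, -, hev3⟩ := hev t (left_ne_zero_of_mul ht)
  let y : Fin N → Fin n → ℂ := fun j l => ev' j (mk (X l))
  have hy : ∀ j r, ev' j (mk r) = aeval (y j) r := by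
    intro j r
    have : (ev' j).comp mk = aeval (y j) := by ext l; simp [y]
    exact DFunLike.congr_fun this r
  refine ⟨M, _, hf _ (right_ne_zero_of_mul ht), y, fun i j hij => ?_, fun j => ⟨fun r hr => ?_,
    fun s => ?_⟩⟩
  · by_contra h
    exact hev3 i j h (by simp only [hy, hij])
  · rw [← hy, show mk r = 0 from Ideal.Quotient.eq_zero_iff_mem.2 hr, map_zero]
  · have := hev1 j s
    simp only [Polynomial.eval_sub, Polynomial.eval_C, Polynomial.eval_mul, Polynomial.eval_X,
      map_sub, map_mul, hy, hg, AlgHom.commutes] at this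
    simp at this
    simp
    linear_combination this

theorem Matrix.exists_mul_mul_eq_one {K r c : Type*} [Field K] [Fintype r] [Fintype c]
    [DecidableEq r] [DecidableEq c] {k : ℕ} (M : Matrix r c K) (h : k ≤ M.rank) :
    ∃ (P : Matrix (Fin k) r K) (Q : Matrix c (Fin k) K), P * M * Q = 1 := by
  let b := Module.finBasis K M.mulVecLin.range
  have hb : LinearIndependent K fun i : Fin k => (b (Fin.castLE h i) : r → K) :=
    (b.linearIndependent.map' _ (Submodule.ker_subtype _)).comp _ (Fin.castLE_injective h)
  have hv : ∀ i : Fin k, ∃ v, M.mulVecLin v = b (Fin.castLE h i) := fun i =>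
    (b (Fin.castLE h i)).2
  choose v hv using hv
  have hinj : Function.Injective (M.mulVecLin ∘ₗ Fintype.linearCombination K v) := by
    have : M.mulVecLin ∘ₗ Fintype.linearCombination K v =
        Fintype.linearCombination K fun i : Fin k => (b (Fin.castLE h i) : r → K) := by
      refine LinearMap.ext fun x => ?_
      simp [Fintype.linearCombination_apply, map_sum, ← hv]
    rw [this]
    exact hb.fintypeLinearCombination_injective
  obtain ⟨g, hg⟩ := LinearMap.exists_leftInverse_of_injective _ (LinearMap.ker_eq_bot.2 hinj)
  refine ⟨LinearMap.toMatrix' g, LinearMap.toMatrix' (Fintype.linearCombination K v), ?_⟩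
  have hM : LinearMap.toMatrix' M.mulVecLin = M := LinearMap.toMatrix'_toLin' M
  rw [Matrix.mul_assoc]
  nth_rw 1 [← hM]
  rw [← LinearMap.toMatrix'_comp, ← LinearMap.toMatrix'_comp, hg, LinearMap.toMatrix'_id]

theorem Matrix.le_rank_of_det_ne_zero {K r c : Type*} [Field K] [Fintype r] [Fintype c]
    {k : ℕ} (M : Matrix r c K) (P : Matrix (Fin k) r K) (Q : Matrix c (Fin k) K)
    (h : (P * M * Q).det ≠ 0) : k ≤ M.rank := by
  have h1 := Matrix.rank_of_det_ne_zero h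
  rw [Fintype.card_fin] at h1
  rw [← h1]
  exact (Matrix.rank_mul_le_left _ _).trans (Matrix.rank_mul_le_right _ _)

/-- A generalized minor of a matrix of polynomials. -/
noncomputable def genMinor {σ r c : Type} [Fintype r] [Fintype c] {k : ℕ}
    (M : Matrix r c (MvPolynomial σ ℂ)) (P : Matrix (Fin k) r ℂ) (Q : Matrix c (Fin k) ℂ) :
    MvPolynomial σ ℂ :=
  (P.map (C : ℂ →+* MvPolynomial σ ℂ) * M * Q.map (C : ℂ →+* MvPolynomial σ ℂ)).det

theorem eval_genMinor {σ r c : Type} [Fintype r] [Fintype c] {k : ℕ}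
    (M : Matrix r c (MvPolynomial σ ℂ)) (P : Matrix (Fin k) r ℂ) (Q : Matrix c (Fin k) ℂ)
    (x : σ → ℂ) : eval x (genMinor M P Q) = (P * M.map (eval x) * Q).det := by
  rw [genMinor, RingHom.map_det, RingHom.mapMatrix_apply, Matrix.map_mul, Matrix.map_mul]
  congr 3 <;> ext <;> simp

theorem exists_genMinor_ne_zero {σ r c : Type} [Fintype r] [Fintype c] {k : ℕ}
    (M : Matrix r c (MvPolynomial σ ℂ)) (x : σ → ℂ) (h : k ≤ (M.map (eval x)).rank) :
    ∃ (P : Matrix (Fin k) r ℂ) (Q : Matrix c (Fin k) ℂ), eval x (genMinor M P Q) ≠ 0 := by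
  classical
  obtain ⟨P, Q, hPQ⟩ := (M.map (eval x)).exists_mul_mul_eq_one h
  exact ⟨P, Q, by rw [eval_genMinor, hPQ]; simp⟩

theorem le_rank_of_genMinor_ne_zero {σ r c : Type} [Fintype r] [Fintype c] {k : ℕ}
    {M : Matrix r c (MvPolynomial σ ℂ)} {x : σ → ℂ} {P : Matrix (Fin k) r ℂ}
    {Q : Matrix c (Fin k) ℂ} (h : eval x (genMinor M P Q) ≠ 0) : k ≤ (M.map (eval x)).rank :=
  Matrix.le_rank_of_det_ne_zero _ P Q (by rwa [← eval_genMinor])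

theorem subset_zcl {σ : Type} (T : Set (σ → ℂ)) : T ⊆ zcl T := fun x hx _ hf =>
  hf x hx

theorem vanishingIdeal_zcl {σ : Type} (T : Set (σ → ℂ)) :
    vanishingIdeal ℂ (zcl T) = vanishingIdeal ℂ T :=
  le_antisymm (fun _ hf x hx => hf x (subset_zcl T hx)) fun _ hf _ hx => hx _ hf

theorem eval_eq_zero_of_mem_zcl {σ : Type} {T : Set (σ → ℂ)} {x : σ → ℂ} (hx : x ∈ zcl T)
    {f : MvPolynomial σ ℂ} (hf : ∀ y ∈ T, eval y f = 0) : eval x f = 0 := by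
  have := hx f fun y hy => by simpa using hf y hy
  simpa using this

theorem rank_le_of_mem_zcl {σ r c : Type} [Fintype r] [Fintype c] {k : ℕ} {T : Set (σ → ℂ)}
    {M : Matrix r c (MvPolynomial σ ℂ)} (hT : ∀ y ∈ T, (M.map (eval y)).rank ≤ k) {x : σ → ℂ}
    (hx : x ∈ zcl T) : (M.map (eval x)).rank ≤ k := by
  by_contra hlt
  obtain ⟨P, Q, hPQ⟩ := exists_genMinor_ne_zero M x (Nat.lt_of_not_le hlt)
  refine hPQ (eval_eq_zero_of_mem_zcl hx fun y hy => ?_)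
  by_contra hne
  exact absurd (le_rank_of_genMinor_ne_zero hne) (by have := hT y hy; omega)

/-- Every irreducible component of the closure of `T` meets `T`. -/
theorem exists_mem_zeroLocus_of_minimalPrimes {σ : Type} [Finite σ] {T : Set (σ → ℂ)}
    {P : Ideal (MvPolynomial σ ℂ)} (hP : P ∈ (vanishingIdeal ℂ T).minimalPrimes) :
    ∃ x ∈ T, x ∈ zeroLocus ℂ P := by
  classical
  by_contra! hcon
  have hPp : P.IsPrime := hP.1.1
  have hfin := (vanishingIdeal ℂ T).finite_minimalPrimes_of_isNoetherianRing
  let s := hfin.toFinset.erase P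
  have hle : s.inf id ≤ P := by
    intro f hf
    refine hP.1.2 fun x hx => ?_
    obtain ⟨Q, hQ, hxQ⟩ := exists_minimalPrimes_mem_zeroLocus (subset_zcl T hx)
    have hQP : Q ≠ P := by
      rintro rfl
      exact hcon x hx hxQ
    have hQs : Q ∈ s := by simp [s, hQP, hQ]
    exact hxQ f ((Finset.inf_le hQs : s.inf id ≤ Q) hf)
  obtain ⟨Q, hQ, hQP⟩ := (hPp.inf_le').1 hle
  have hQ' : Q ≠ P ∧ Q ∈ (vanishingIdeal ℂ T).minimalPrimes := by simpa [s] using hQ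
  exact hQ'.1 (le_antisymm hQP (hP.2 hQ'.2.1 hQP))

/-- The Jacobian matrix of `F` with polynomial entries. -/
noncomputable def jacPoly {n p : ℕ} (F : Fin p → MvPolynomial (Fin n) ℚ) :
    Matrix (Fin p) (Fin n) (MvPolynomial (Fin n) ℂ) :=
  Matrix.of fun k l => map (algebraMap ℚ ℂ) (pderiv l (F k))

theorem jacPoly_map_eval {n p : ℕ} (F : Fin p → MvPolynomial (Fin n) ℚ) (x : Fin n → ℂ) :
    (jacPoly F).map (eval x) = jacC F x := by
  ext k l
  simp [jacPoly, jacC, eval_map, aeval_def]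

/-- The Jacobian with the rows `a_k - ε x` appended: `ε = 0` gives the matrix of the classic
polar variety, `ε = 1` that of the dual one. -/
noncomputable def polarMat {n p m : ℕ} (F : Fin p → MvPolynomial (Fin n) ℚ) (ε : ℂ)
    (a : Matrix (Fin m) (Fin n) ℂ) (x : Fin n → ℂ) : Matrix (Fin p ⊕ Fin m) (Fin n) ℂ :=
  Matrix.fromRows (jacC F x) (Matrix.of fun k l => a k l - ε * x l)

/-- The polynomial version of `polarMat`. -/
noncomputable def polarPoly {n p m : ℕ} (F : Fin p → MvPolynomial (Fin n) ℚ) (ε : ℂ)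
    (a : Matrix (Fin m) (Fin n) ℂ) :
    Matrix (Fin p ⊕ Fin m) (Fin n) (MvPolynomial (Fin n) ℂ) :=
  Matrix.fromRows (jacPoly F) (Matrix.of fun k l => C (a k l) - C ε * X l)

theorem polarPoly_map_eval {n p m : ℕ} (F : Fin p → MvPolynomial (Fin n) ℚ) (ε : ℂ)
    (a : Matrix (Fin m) (Fin n) ℂ) (x : Fin n → ℂ) :
    (polarPoly F ε a).map (eval x) = polarMat F ε a x := by
  ext k l
  rcases k with k | k
  · rw [polarMat, ← jacPoly_map_eval]
    simp [polarPoly]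
  · simp [polarPoly, polarMat]

/-- The set of regular points at which the polar matrix has rank at most `r`. -/
def polarLocus {n p m : ℕ} (F : Fin p → MvPolynomial (Fin n) ℚ) (ε : ℂ)
    (a : Matrix (Fin m) (Fin n) ℂ) (r : ℕ) : Set (Fin n → ℂ) :=
  {x | x ∈ SregC F ∧ (polarMat F ε a x).rank ≤ r}

theorem rank_jacC_le {n p m : ℕ} (F : Fin p → MvPolynomial (Fin n) ℚ) (ε : ℂ)
    (a : Matrix (Fin m) (Fin n) ℂ) (x : Fin n → ℂ) :
    (jacC F x).rank ≤ (polarMat F ε a x).rank :=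
  (polarMat F ε a x).rank_submatrix_le Sum.inl id

theorem rank_polarMat_firstRows_le {n p m m' : ℕ} (F : Fin p → MvPolynomial (Fin n) ℚ) (ε : ℂ)
    (a : Matrix (Fin m) (Fin n) ℂ) (h : m' ≤ m) (x : Fin n → ℂ) :
    (polarMat F ε (firstRows a h) x).rank ≤ (polarMat F ε a x).rank := by
  convert (polarMat F ε a x).rank_submatrix_le (Sum.map id (Fin.castLE h)) id
  ext k l
  rcases k with k | k <;> simp [polarMat, firstRows]

theorem Wclassic_eq {n p m : ℕ} (F : Fin p → MvPolynomial (Fin n) ℚ)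
    (a : Matrix (Fin m) (Fin n) ℂ) (r : ℕ) : Wclassic F a r = zcl (polarLocus F 0 a r) := by
  simp [Wclassic, polarLocus, polarMat]
  rfl

theorem Wdual_eq {n p m : ℕ} (F : Fin p → MvPolynomial (Fin n) ℚ)
    (a : Matrix (Fin m) (Fin n) ℂ) (r : ℕ) : Wdual F a r = zcl (polarLocus F 1 a r) := by
  simp [Wdual, polarLocus, polarMat]

/-- A generic section of the complementary dimension of a polar variety of pure dimension `d`
is finite and consists of regular points at which the polar matrix has the largest rank
allowed. -/
theorem exists_generic_section {n p d : ℕ} (F : Fin p → MvPolynomial (Fin n) ℚ) (ε : ℂ)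
    (a : Matrix (Fin (d + 1)) (Fin n) ℂ)
    (hpure : ∀ P ∈ (vanishingIdeal ℂ (polarLocus F ε a (p + d))).minimalPrimes,
      ringKrullDim (MvPolynomial (Fin n) ℂ ⧸ P) ≤ d) (T : Set (Fin n → ℂ))
    (hT : ∀ x ∈ SregC F, (polarMat F ε a x).rank < p + d → x ∈ T)
    (hTdim : ∀ P ∈ (vanishingIdeal ℂ T).minimalPrimes,
      ringKrullDim (MvPolynomial (Fin n) ℂ ⧸ P) < d)
    (M : Matrix (Fin d) (Fin n) ℂ) :
    ∃ f : MvPolynomial (Fin d) ℂ, f ≠ 0 ∧ ∀ c, eval c f ≠ 0 →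
      {x | x ∈ zcl (polarLocus F ε a (p + d)) ∧ ∀ s, ∑ l, M s l * x l = c s}.Finite ∧
      ∀ x ∈ zcl (polarLocus F ε a (p + d)), (∀ s, ∑ l, M s l * x l = c s) →
        x ∈ SregC F ∧ (polarMat F ε a x).rank = p + d := by
  have hM : ∀ (x : Fin n → ℂ) s, aeval x (linForm (M s)) = ∑ l, M s l * x l := by simp
  obtain ⟨f₁, hf₁, h₁⟩ := exists_generic_fiber_finite _ hpure fun s => linForm (M s)
  obtain ⟨f₂, hf₂, h₂⟩ := exists_generic_of_minimalPrimes
    (vanishingIdeal ℂ (polarLocus F ε a (p + d)))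
    (R := fun c x => (∀ s, ∑ l, M s l * x l = c s) → p ≤ (jacC F x).rank) (by
      intro P hP
      have hPp : P.IsPrime := hP.1.1
      obtain ⟨x, hx, hxP⟩ := exists_mem_zeroLocus_of_minimalPrimes hP
      obtain ⟨A, B, hAB⟩ := exists_genMinor_ne_zero (jacPoly F) x
        (k := p) (by rw [jacPoly_map_eval, hx.1.2])
      obtain ⟨f, hf0, hf⟩ := generic_fiber_ne_zero P (fun s => linForm (M s)) (hpure P hP)
        (h := genMinor (jacPoly F) A B) (fun h => hAB (by simpa using hxP _ h))
      refine ⟨f, hf0, fun c hc y hy hyM => ?_⟩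
      rw [← jacPoly_map_eval]
      exact le_rank_of_genMinor_ne_zero (by
        simpa using hf c hc y hy fun s => by rw [hM, hyM]))
  obtain ⟨f₃, hf₃, h₃⟩ := exists_generic_of_minimalPrimes (vanishingIdeal ℂ T)
    (R := fun c x => ¬ ∀ s, ∑ l, M s l * x l = c s) (by
      intro P hP
      have hPp : P.IsPrime := hP.1.1
      simpa only [hM] using generic_fiber_empty P (fun s => linForm (M s)) (hTdim P hP))
  refine ⟨f₁ * f₂ * f₃, mul_ne_zero (mul_ne_zero hf₁ hf₂) hf₃, fun c hc => ?_⟩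
  rw [map_mul, map_mul] at hc
  have hc₁ := left_ne_zero_of_mul (left_ne_zero_of_mul hc)
  have hc₂ := right_ne_zero_of_mul (left_ne_zero_of_mul hc)
  have hc₃ := right_ne_zero_of_mul hc
  refine ⟨by simpa only [hM, zcl] using h₁ c hc₁, fun x hx hxc => ?_⟩
  have hreg : x ∈ SregC F := by
    refine ⟨fun k => ?_, le_antisymm (by simpa using (jacC F x).rank_le_card_height)
      (h₂ c hc₂ x hx hxc)⟩
    have := eval_eq_zero_of_mem_zcl hx (f := map (algebraMap ℚ ℂ) (F k)) fun y hy => by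
      have := hy.1.1 k
      rwa [eval_map, ← aeval_def]
    rwa [eval_map, ← aeval_def] at this
  refine ⟨hreg, le_antisymm ?_ (not_lt.1 fun hlt =>
    h₃ c hc₃ x (subset_zcl T (hT x hreg hlt)) hxc)⟩
  rw [← polarPoly_map_eval]
  exact rank_le_of_mem_zcl (fun y hy => by rw [polarPoly_map_eval]; exact hy.2) hx

theorem Matrix.finrank_ker_transpose_add_rank {K r c : Type*} [Field K] [Fintype r] [Fintype c]
    (M : Matrix r c K) :
    Module.finrank K (LinearMap.ker Mᵀ.mulVecLin) + M.rank = Fintype.card r := by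
  rw [← M.rank_transpose, add_comm]
  simpa [Matrix.rank] using Mᵀ.mulVecLin.finrank_range_add_finrank_ker

theorem Matrix.exists_vecMul_eq_zero_of_rank_lt {K r c : Type*} [Field K] [Fintype r] [Fintype c]
    {M : Matrix r c K} (h : M.rank < Fintype.card r) : ∃ w ≠ 0, Matrix.vecMul w M = 0 := by
  have h1 := M.finrank_ker_transpose_add_rank
  have : Nontrivial (LinearMap.ker Mᵀ.mulVecLin) :=
    Module.nontrivial_of_finrank_pos (R := K) (by omega)
  obtain ⟨w, hw⟩ := exists_ne (0 : LinearMap.ker Mᵀ.mulVecLin)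
  refine ⟨w, by simpa using hw, ?_⟩
  have := w.2
  rwa [LinearMap.mem_ker, Matrix.mulVecLin_apply, Matrix.mulVec_transpose] at this

theorem Matrix.rank_lt_of_vecMul_eq_zero {K r c : Type*} [Field K] [Fintype r] [Fintype c]
    {M : Matrix r c K} {w : r → K} (hw : w ≠ 0) (h : Matrix.vecMul w M = 0) :
    M.rank < Fintype.card r := by
  have h1 := M.finrank_ker_transpose_add_rank
  have h2 : w ∈ LinearMap.ker Mᵀ.mulVecLin := by
    rw [LinearMap.mem_ker, Matrix.mulVecLin_apply, Matrix.mulVec_transpose, h]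
  have : 0 < Module.finrank K (LinearMap.ker Mᵀ.mulVecLin) :=
    Module.finrank_pos_iff_exists_ne_zero.2 ⟨⟨w, h2⟩, by simpa using hw⟩
  omega

theorem Matrix.eq_of_vecMul_eq_zero {K r c : Type*} [Field K] [Fintype r] [Fintype c]
    {M : Matrix r c K} (hM : M.rank + 1 = Fintype.card r) {w w' : r → K}
    (h : Matrix.vecMul w M = 0) (h' : Matrix.vecMul w' M = 0) {k : r} (hk : w k = 1)
    (hk' : w' k = 1) : w = w' := by
  have h1 := M.finrank_ker_transpose_add_rank
  have hmem : ∀ w, Matrix.vecMul w M = 0 → w ∈ LinearMap.ker Mᵀ.mulVecLin := fun w h => by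
    rw [LinearMap.mem_ker, Matrix.mulVecLin_apply, Matrix.mulVec_transpose, h]
  have hw0 : (⟨w, hmem w h⟩ : LinearMap.ker Mᵀ.mulVecLin) ≠ 0 := fun h0 => by
    have : w k = 0 := congrFun (congrArg Subtype.val h0) k
    simp [this] at hk
  have h2 : Module.finrank K (LinearMap.ker Mᵀ.mulVecLin) = 1 := by omega
  obtain ⟨e, he⟩ := (finrank_eq_one_iff_of_nonzero' _ hw0).1 h2 ⟨w', hmem w' h'⟩
  have he' : e • w = w' := congrArg Subtype.val he
  have : e = 1 := by simpa [hk, hk'] using congrFun he' k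
  simpa [this] using he'

/-- The Lagrange multiplier system describing the section of a polar variety by an affine
subspace, moving linearly with the parameter. -/
noncomputable def lagrangeSys {n p m d : ℕ} (F : Fin p → MvPolynomial (Fin n) ℚ) (ε : ℂ)
    (a V : Matrix (Fin m) (Fin n) ℂ) (M : Matrix (Fin d) (Fin n) ℂ) (c v : Fin d → ℂ)
    (k : Fin m) : Fin p ⊕ Fin n ⊕ Unit ⊕ Fin d →
      Polynomial (MvPolynomial (Fin n ⊕ Fin p ⊕ Fin m) ℂ) :=
  Sum.elim (fun i => Polynomial.C (rename Sum.inl (map (algebraMap ℚ ℂ) (F i)))) <|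
  Sum.elim (fun l =>
    ∑ i, Polynomial.C (X (Sum.inr (Sum.inl i)) * rename Sum.inl (jacPoly F i l)) +
    ∑ i, Polynomial.C (X (Sum.inr (Sum.inr i))) *
      (Polynomial.C (C (a i l) - C ε * X (Sum.inl l)) + Polynomial.C (C (V i l)) * Polynomial.X)) <|
  Sum.elim (fun _ => Polynomial.C (X (Sum.inr (Sum.inr k)) - 1)) fun s =>
    Polynomial.C (rename Sum.inl (linForm (M s)) - C (c s)) - Polynomial.C (C (v s)) * Polynomial.X

theorem eval_lagrangeSys {n p m d : ℕ} (F : Fin p → MvPolynomial (Fin n) ℚ) (ε : ℂ)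
    (a V : Matrix (Fin m) (Fin n) ℂ) (M : Matrix (Fin d) (Fin n) ℂ) (c v : Fin d → ℂ)
    (k : Fin m) (t : ℂ) (z : Fin n ⊕ Fin p ⊕ Fin m → ℂ) :
    (∀ s, aeval z ((lagrangeSys F ε a V M c v k s).eval (C t)) = 0) ↔
      z ∘ Sum.inl ∈ zeroSetC F ∧
      Matrix.vecMul (z ∘ Sum.inr) (polarMat F ε (a + t • V) (z ∘ Sum.inl)) = 0 ∧
      z (Sum.inr (Sum.inr k)) = 1 ∧
      ∀ s, ∑ l, M s l * z (Sum.inl l) = c s + t * v s := by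
  rw [Sum.forall, Sum.forall, Sum.forall]
  refine and_congr ?_ (and_congr ?_ (and_congr ?_ ?_))
  · refine forall_congr' fun i => ?_
    simp [lagrangeSys, eval_rename, eval_map, aeval_def]
  · rw [funext_iff]
    refine forall_congr' fun l => ?_
    have hJ : ∀ i, aeval (z ∘ Sum.inl) (jacPoly F i l) = jacC F (z ∘ Sum.inl) i l := fun i => by
      rw [← jacPoly_map_eval]; simp
    simp only [lagrangeSys, Sum.elim_inr, Sum.elim_inl, Polynomial.eval_add,
      Polynomial.eval_sub,
      Polynomial.eval_finsetSum, Polynomial.eval_C, Polynomial.eval_mul, Polynomial.eval_X,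
      map_add, map_sum, map_mul, map_sub, aeval_X, aeval_rename, hJ, aeval_C,
      Matrix.vecMul, dotProduct, Fintype.sum_sum_type, polarMat, Matrix.fromRows_apply_inl,
      Matrix.fromRows_apply_inr, Matrix.of_apply, Matrix.add_apply, Matrix.smul_apply,
      smul_eq_mul, Function.comp_apply, Pi.zero_apply, Algebra.algebraMap_self, RingHom.id_apply]
    refine Eq.congr (congrArg₂ _ rfl (Finset.sum_congr rfl fun i _ => ?_)) rfl
    ring
  · simp [lagrangeSys, sub_eq_zero]
  · refine forall_congr' fun s => ?_
    have h : aeval z ((lagrangeSys F ε a V M c v k (Sum.inr (Sum.inr (Sum.inr s)))).eval (C t)) =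
        ∑ l, M s l * z (Sum.inl l) - (c s + t * v s) := by
      have hlin : aeval (z ∘ Sum.inl) (linForm (M s)) = ∑ l, M s l * z (Sum.inl l) := by simp
      simp only [lagrangeSys, Sum.elim_inr, Polynomial.eval_sub, Polynomial.eval_C,
        Polynomial.eval_mul, Polynomial.eval_X, map_sub, map_mul, aeval_rename, aeval_C,
        hlin, Algebra.algebraMap_self, RingHom.id_apply]
      ring
    rw [h, sub_eq_zero]

theorem exists_lagrange_multiplier {n p m : ℕ} {F : Fin p → MvPolynomial (Fin n) ℚ} {ε : ℂ}
    {a : Matrix (Fin m) (Fin n) ℂ} {x : Fin n → ℂ} (hx : (jacC F x).rank = p)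
    (h : (polarMat F ε a x).rank < p + m) :
    ∃ (k : Fin m) (w : Fin p ⊕ Fin m → ℂ), w (Sum.inr k) = 1 ∧ w ᵥ* polarMat F ε a x = 0 := by
  obtain ⟨w, hw0, hw⟩ := Matrix.exists_vecMul_eq_zero_of_rank_lt
    (M := polarMat F ε a x) (by simpa using h)
  by_cases hk : ∃ k, w (Sum.inr k) ≠ 0
  · obtain ⟨k, hk⟩ := hk
    exact ⟨k, (w (Sum.inr k))⁻¹ • w, by simp [hk], by rw [Matrix.smul_vecMul, hw, smul_zero]⟩
  · push Not at hk
    have h1 : (w ∘ Sum.inl) ᵥ* jacC F x = 0 := by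
      ext l
      have := congrFun hw l
      simpa [Matrix.vecMul, dotProduct, polarMat, hk] using this
    have h2 : w ∘ Sum.inl ≠ 0 := fun h0 => hw0 (by
      ext (i | k)
      · exact congrFun h0 i
      · exact hk k)
    have := Matrix.rank_lt_of_vecMul_eq_zero h2 h1
    simp [hx] at this

/-- Points of a generic section of a polar variety survive a perturbation of the defining
matrix and of the section. -/
theorem exists_points_polarLocus_perturbed {n p d N : ℕ} (F : Fin p → MvPolynomial (Fin n) ℚ)
    (ε : ℂ) (a V : Matrix (Fin (d + 1)) (Fin n) ℂ) (M : Matrix (Fin d) (Fin n) ℂ)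
    (c v : Fin d → ℂ) (x : Fin N → Fin n → ℂ) (hxinj : Function.Injective x)
    (hxreg : ∀ j, x j ∈ SregC F) (hxrank : ∀ j, (polarMat F ε a (x j)).rank = p + d)
    (hxM : ∀ j s, ∑ l, M s l * x j l = c s)
    (hfin : {x | x ∈ polarLocus F ε a (p + d) ∧ ∀ s, ∑ l, M s l * x l = c s}.Finite) :
    ∃ f : Polynomial ℂ, f ≠ 0 ∧ ∀ t, f.eval t ≠ 0 → ∃ y : Fin N → Fin n → ℂ,
      Function.Injective y ∧ ∀ j, y j ∈ polarLocus F ε (a + t • V) (p + d) ∧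
        ∀ s, ∑ l, M s l * y j l = c s + t * v s := by
  choose k w hwk hw using fun j => exists_lagrange_multiplier (hxreg j).2
    (by rw [hxrank j]; omega : (polarMat F ε a (x j)).rank < p + (d + 1))
  let z : Fin N → Fin n ⊕ Fin p ⊕ Fin (d + 1) → ℂ := fun j => Sum.elim (x j) (w j)
  choose A B hAB using fun j => exists_genMinor_ne_zero (jacPoly F) (x j)
    (k := p) (by rw [jacPoly_map_eval, (hxreg j).2])
  choose A' B' hAB' using fun j => exists_genMinor_ne_zero (polarPoly F ε a) (x j)
    (k := p + d) (by rw [polarPoly_map_eval, hxrank j])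
  have hsep : ∀ i j, ∃ q : MvPolynomial (Fin n) ℂ, i ≠ j → eval (x i) q ≠ eval (x j) q := by
    intro i j
    by_cases hij : i = j
    · exact ⟨0, fun h => absurd hij h⟩
    · obtain ⟨l, hl⟩ := Function.ne_iff.1 (hxinj.ne hij)
      exact ⟨X l, fun _ => by simpa using hl⟩
  choose q hq using hsep
  have heval : ∀ (y : Fin n ⊕ Fin p ⊕ Fin (d + 1) → ℂ) r,
      aeval y (rename Sum.inl r) = eval (y ∘ Sum.inl) r := by
    intro y r
    simp [aeval_rename]
  have hz0 : ∀ j (y : Fin n ⊕ Fin p ⊕ Fin (d + 1) → ℂ),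
      y ∈ zeroLocus ℂ (Ideal.span (Set.range fun s =>
        (lagrangeSys F ε a V M c v (k j) s).eval 0)) ↔
      y ∘ Sum.inl ∈ zeroSetC F ∧ (y ∘ Sum.inr) ᵥ* polarMat F ε a (y ∘ Sum.inl) = 0 ∧
      y (Sum.inr (Sum.inr (k j))) = 1 ∧ ∀ s, ∑ l, M s l * y (Sum.inl l) = c s := by
    intro j y
    have := eval_lagrangeSys F ε a V M c v (k j) 0 y
    rw [map_zero] at this
    simp only [zero_smul, add_zero, zero_mul] at this
    rw [← this, zeroLocus_span]
    exact Set.forall_mem_range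
  obtain ⟨f, hf0, hf⟩ := exists_points_perturbed (A := MvPolynomial (Fin n ⊕ Fin p ⊕ Fin (d + 1)) ℂ)
    (fun j => aeval (z j))
    (fun j => by
      rw [MvPolynomial.height_of_isMaximal]
      simp only [Fintype.card_sum, Fintype.card_fin, Fintype.card_unit]
      exact_mod_cast (by omega))
    (fun j => lagrangeSys F ε a V M c v (k j))
    (fun j => by
      have hker : RingHom.ker (aeval (R := ℂ) (z j)) = vanishingIdeal ℂ {z j} := by
        ext r
        simp [mem_vanishingIdeal_iff]
      rw [hker]
      refine mem_minimalPrimes_of_finite _ ((hz0 j _).2 ⟨(hxreg j).1, hw j, hwk j, hxM j⟩)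
        (rename Sum.inl (genMinor (jacPoly F) (A j) (B j) *
          genMinor (polarPoly F ε a) (A' j) (B' j)))
        (by
          rw [heval, map_mul]
          exact mul_ne_zero (hAB j) (hAB' j)) ?_
      have hgood : ∀ y ∈ {y | y ∈ zeroLocus ℂ (Ideal.span (Set.range fun s =>
          (lagrangeSys F ε a V M c v (k j) s).eval 0)) ∧ aeval y (rename Sum.inl
          (genMinor (jacPoly F) (A j) (B j) * genMinor (polarPoly F ε a) (A' j) (B' j))) ≠ 0},
          y ∘ Sum.inl ∈ SregC F ∧ (polarMat F ε a (y ∘ Sum.inl)).rank = p + d := by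
        rintro y ⟨hy, hyδ⟩
        obtain ⟨hy1, hy2, hy3, -⟩ := (hz0 j y).1 hy
        rw [heval, map_mul] at hyδ
        have h1 := le_rank_of_genMinor_ne_zero (left_ne_zero_of_mul hyδ)
        have h2 := le_rank_of_genMinor_ne_zero (right_ne_zero_of_mul hyδ)
        rw [jacPoly_map_eval] at h1
        rw [polarPoly_map_eval] at h2
        refine ⟨⟨hy1, le_antisymm (by simpa using (jacC F _).rank_le_card_height) h1⟩,
          le_antisymm ?_ h2⟩
        have := Matrix.rank_lt_of_vecMul_eq_zero (fun h0 => by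
          have : y (Sum.inr (Sum.inr (k j))) = 0 := congrFun h0 _
          simp [this] at hy3) hy2
        simp only [Fintype.card_sum, Fintype.card_fin] at this
        omega
      refine Set.Finite.of_finite_image (f := fun y => y ∘ Sum.inl) (hfin.subset ?_) ?_
      · rintro _ ⟨y, hy, rfl⟩
        exact ⟨⟨(hgood y hy).1, (hgood y hy).2.le⟩, ((hz0 j y).1 hy.1).2.2.2⟩
      · intro y hy y' hy' hyy'
        obtain ⟨-, hy2, hy3, -⟩ := (hz0 j y).1 hy.1
        obtain ⟨-, hy2', hy3', -⟩ := (hz0 j y').1 hy'.1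
        have hyy : y ∘ Sum.inl = y' ∘ Sum.inl := hyy'
        rw [← hyy] at hy2'
        have := Matrix.eq_of_vecMul_eq_zero (by
          rw [(hgood y hy).2]
          simp [add_assoc]) hy2 hy2' (k := Sum.inr (k j)) hy3 hy3'
        ext (l | i)
        · exact congrFun hyy l
        · exact congrFun this i)
    (fun j => Polynomial.C (rename Sum.inl (genMinor (jacPoly F) (A j) (B j))))
    (fun j => by
      rw [Polynomial.eval_C, heval]
      exact hAB j)
    (fun i j => rename Sum.inl (q i j))
    (fun i j hij => by
      rw [heval, heval]
      exact hq i j hij)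
  refine ⟨f, hf0, fun t ht => ?_⟩
  obtain ⟨ev', h1, h2, h3⟩ := hf t ht
  let y : Fin N → Fin n ⊕ Fin p ⊕ Fin (d + 1) → ℂ := fun j l => ev' j (X l)
  have hev : ∀ j, ev' j = aeval (y j) := fun j => by ext l; simp [y]
  simp only [hev, Polynomial.eval_C, heval] at h1 h2 h3
  refine ⟨fun j => y j ∘ Sum.inl, fun i j hij => ?_, fun j => ?_⟩
  · by_contra hne
    exact h3 i j hne (congrArg (fun u => eval u (q i j)) hij)
  · obtain ⟨hy1, hy2, hy3, hy4⟩ := (eval_lagrangeSys F ε a V M c v (k j) t (y j)).1 (h1 j)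
    have hr := le_rank_of_genMinor_ne_zero (h2 j)
    rw [jacPoly_map_eval] at hr
    refine ⟨⟨⟨hy1, le_antisymm (by simpa using (jacC F _).rank_le_card_height) hr⟩, ?_⟩, hy4⟩
    have := Matrix.rank_lt_of_vecMul_eq_zero (fun h0 => by
      have : y j (Sum.inr (Sum.inr (k j))) = 0 := congrFun h0 _
      simp [this] at hy3) hy2
    simp only [Fintype.card_sum, Fintype.card_fin] at this
    exact Nat.le_of_lt_succ this

theorem MvPolynomial.dense_eval_ne_zero {d : ℕ} {f : MvPolynomial (Fin d) ℂ} (hf : f ≠ 0) :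
    Dense {v : Fin d → ℂ | eval v f ≠ 0} := by
  intro c
  obtain ⟨c', hc'⟩ := MvPolynomial.exists_eval_ne_zero hf
  have hline : f.toLine c (c' - c) ≠ 0 := fun h => hc' (by
    have := eval_toLine c (c' - c) f 1
    rw [h] at this
    simpa using this.symm)
  have hd : Dense {t | (f.toLine c (c' - c)).eval t ≠ 0} := by
    have := Polynomial.finite_setOfPred_isRoot hline
    exact this.countable.dense_compl ℝ
  have hcont : Continuous fun t : ℂ => c + t • (c' - c) := by fun_prop
  have h0 := hcont.continuousAt.continuousWithinAt.mem_closure_image (hd 0)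
  rw [zero_smul, add_zero] at h0
  refine closure_mono ?_ h0
  rintro _ ⟨t, ht, rfl⟩
  simpa only [Set.mem_ofPred_eq, eval_toLine] using ht

/-- Countably many nonzero polynomials have a common point of nonvanishing. -/
theorem MvPolynomial.exists_forall_eval_ne_zero {d : ℕ} {ι : Type*} [Countable ι]
    {f : ι → MvPolynomial (Fin d) ℂ} (hf : ∀ i, f i ≠ 0) : ∃ v, ∀ i, eval v (f i) ≠ 0 := by
  have h : Dense (⋂ i, {v : Fin d → ℂ | eval v (f i) ≠ 0}) :=
    dense_iInter_of_isOpen (fun i => isOpen_ne_fun (continuous_eval _) continuous_const)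
      fun i => dense_eval_ne_zero (hf i)
  obtain ⟨v, hv⟩ := h.nonempty
  exact ⟨v, Set.mem_iInter.1 hv⟩

theorem MvPolynomial.exists_forall_eval_add_smul_ne_zero {d : ℕ} {ι : Type*} [Countable ι]
    {f : ι → MvPolynomial (Fin d) ℂ} (hf : ∀ i, f i ≠ 0) (c : Fin d → ℂ) {τ : ι → ℂ}
    (hτ : ∀ i, τ i ≠ 0) : ∃ v, ∀ i, eval (c + τ i • v) (f i) ≠ 0 := by
  have key : ∀ i v, eval v (bind₁ (fun s => C (c s) + C (τ i) * X s) (f i)) =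
      eval (c + τ i • v) (f i) := by
    intro i v
    rw [← coe_aeval_eq_eval, RingHom.coe_coe, aeval_bind₁]
    simp
    rfl
  obtain ⟨v, hv⟩ := exists_forall_eval_ne_zero
    (f := fun i => bind₁ (fun s => C (c s) + C (τ i) * X s) (f i)) (fun i h0 => by
      obtain ⟨c', hc'⟩ := MvPolynomial.exists_eval_ne_zero (hf i)
      refine hc' ?_
      have := key i ((τ i)⁻¹ • (c' - c))
      rw [h0, map_zero, smul_inv_smul₀ (hτ i), add_sub_cancel] at this
      exact this.symm)
  exact ⟨v, fun i => by rw [← key]; exact hv i⟩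

/-- The affine subspace defined by a system of linear equations. -/
def linearSection {n d : ℕ} (M : Matrix (Fin d) (Fin n) ℂ) (c : Fin d → ℂ) :
    AffineSubspace ℂ (Fin n → ℂ) where
  carrier := {x | ∀ s, ∑ l, M s l * x l = c s}
  smul_vsub_vadd_mem' := by
    intro e x y z hx hy hz s
    have : ∑ l, M s l * (e • (x -ᵥ y) +ᵥ z) l =
        e * (∑ l, M s l * x l - ∑ l, M s l * y l) + ∑ l, M s l * z l := by
      rw [← Finset.sum_sub_distrib, Finset.mul_sum, ← Finset.sum_add_distrib]
      refine Finset.sum_congr rfl fun l _ => ?_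
      simp
      ring
    rw [this, hx s, hy s, hz s]
    ring

theorem card_le_geomDeg {n N : ℕ} {V : Set (Fin n → ℂ)} {E : AffineSubspace ℂ (Fin n → ℂ)}
    (hfin : (V ∩ (E : Set (Fin n → ℂ))).Finite) {y : Fin N → Fin n → ℂ}
    (hy : Function.Injective y) (hyV : ∀ j, y j ∈ V ∩ (E : Set (Fin n → ℂ))) :
    (N : ℕ∞) ≤ geomDeg V := by
  refine le_trans ?_ (le_sSup ⟨E, hfin, rfl⟩)
  have h1 := Set.ncard_le_ncard (Set.range_subset_iff.2 hyV) hfin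
  rw [← Set.image_univ, Set.ncard_image_of_injective _ hy, Set.ncard_univ, Nat.card_fin] at h1
  exact_mod_cast h1

/-- The geometric degree of a polar variety of pure dimension does not exceed that of the nearby
ones in a pencil. -/
theorem geomDeg_polarLocus_le {n p d : ℕ} (F : Fin p → MvPolynomial (Fin n) ℚ) (ε : ℂ)
    (a V : Matrix (Fin (d + 1)) (Fin n) ℂ) (hpure : IsPureDim (polarLocus F ε a (p + d)) d)
    (T : Set (Fin n → ℂ)) (hT : ∀ x ∈ SregC F, (polarMat F ε a x).rank < p + d → x ∈ T)
    (hTdim : ∀ P ∈ (vanishingIdeal ℂ T).minimalPrimes,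
      ringKrullDim (MvPolynomial (Fin n) ℂ ⧸ P) < d)
    {Λ : Set ℂ} (hΛc : Λ.Countable) (hΛi : Λ.Infinite) (hΛ0 : ∀ t ∈ Λ, t ≠ 0)
    (hΛpure : ∀ t ∈ Λ, IsPureDim (polarLocus F ε (a + t • V) (p + d)) d) {δ : ℕ∞}
    (hΛdeg : ∀ t ∈ Λ, geomDeg (zcl (polarLocus F ε (a + t • V) (p + d))) ≤ δ) :
    geomDeg (zcl (polarLocus F ε a (p + d))) ≤ δ := by
  refine sSup_le ?_
  rintro _ ⟨E, hfin, rfl⟩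
  rw [Set.ncard_eq_toFinset_card _ hfin]
  let x : Fin hfin.toFinset.card → Fin n → ℂ := fun j => hfin.toFinset.equivFin.symm j
  have hx : ∀ j, x j ∈ zcl (polarLocus F ε a (p + d)) ∩ (E : Set (Fin n → ℂ)) := fun j =>
    hfin.mem_toFinset.1 (hfin.toFinset.equivFin.symm j).2
  obtain ⟨M, c, ⟨hMfin, hMreg⟩, y, hyinj, hy⟩ := exists_generic_slice _ hpure E hfin x
    (Subtype.val_injective.comp (Equiv.injective _)) (fun j => (hx j).1) (fun j => (hx j).2) _
    (exists_generic_section F ε a (fun P hP => (hpure P hP).le) T hT hTdim)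
  have hreg := fun j => hMreg (y j) (hy j).1 (hy j).2
  choose f hf0 hf using fun t : Λ => exists_generic_fiber_finite _
    (fun P hP => (hΛpure t t.2 P hP).le) fun s => linForm (M s)
  have := hΛc.to_subtype
  obtain ⟨v, hv⟩ := exists_forall_eval_add_smul_ne_zero hf0 c fun t : Λ => hΛ0 t t.2
  obtain ⟨g, hg0, hg⟩ := exists_points_polarLocus_perturbed F ε a V M c v y hyinj
    (fun j => (hreg j).1) (fun j => (hreg j).2) (fun j => (hy j).2)
    (hMfin.subset fun x hx => ⟨subset_zcl _ hx.1, hx.2⟩)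
  obtain ⟨t, htΛ, ht⟩ := (hΛi.sdiff (Polynomial.finite_setOfPred_isRoot hg0)).nonempty
  obtain ⟨y', hyinj', hy'⟩ := hg t ht
  refine (card_le_geomDeg (E := linearSection M (c + t • v)) ?_ hyinj' fun j =>
    ⟨subset_zcl _ (hy' j).1, (hy' j).2⟩).trans (hΛdeg t htΛ)
  refine (hf ⟨t, htΛ⟩ _ (hv ⟨t, htΛ⟩)).subset fun x hx => ⟨hx.1, fun s => ?_⟩
  simpa using hx.2 s

theorem isPureDim_zcl_iff {σ : Type} {T : Set (σ → ℂ)} {d : ℕ} :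
    IsPureDim (zcl T) d ↔ IsPureDim T d := by
  rw [IsPureDim, vanishingIdeal_zcl, IsPureDim]

theorem minimalPrimes_vanishingIdeal_empty {σ : Type} :
    (vanishingIdeal ℂ (∅ : Set (σ → ℂ))).minimalPrimes = ∅ := by
  rw [vanishingIdeal_empty, Ideal.minimalPrimes_top]

theorem isPureDim_of_eq_empty_or {σ : Type} {T : Set (σ → ℂ)} {d : ℕ}
    (h : T = ∅ ∨ IsPureDim T d) : IsPureDim T d := by
  rcases h with rfl | h
  · simp only [IsPureDim, minimalPrimes_vanishingIdeal_empty]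
    exact fun _ h => absurd h (Set.notMem_empty _)
  · exact h

/-- A line through a point of a nonempty Zariski open set of matrices meets it in a countably
infinite set of nonzero parameters. -/
theorem ZOpenMat.exists_countable_infinite {m n : ℕ} {U : Set (Matrix (Fin m) (Fin n) ℂ)}
    (hU : ZOpenMat U) {b : Matrix (Fin m) (Fin n) ℂ} (hb : b ∈ U) (a : Matrix (Fin m) (Fin n) ℂ) :
    ∃ Λ : Set ℂ, Λ.Countable ∧ Λ.Infinite ∧ ∀ t ∈ Λ, t ≠ 0 ∧ a + t • (b - a) ∈ U := by
  obtain ⟨I, rfl⟩ := hU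
  obtain ⟨f, hfI, hf⟩ := hb
  let g := f.toLine (fun q => a q.1 q.2) fun q => (b - a) q.1 q.2
  have hg : ∀ t, g.eval t = eval (fun q => (a + t • (b - a)) q.1 q.2) f := fun t =>
    eval_toLine _ _ _ _
  have hg0 : g ≠ 0 := fun h => hf (by
    have := hg 1
    rw [h, Polynomial.eval_zero, one_smul, add_sub_cancel] at this
    exact this.symm)
  refine ⟨(Set.range ((↑) : ℕ → ℂ) \ {t | g.IsRoot t}) \ {0},
    ((Set.countable_range _).mono Set.sdiff_subset).mono Set.sdiff_subset,
    ((Set.infinite_range_of_injective Nat.cast_injective).sdiff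
      (Polynomial.finite_setOfPred_isRoot hg0)).sdiff (Set.finite_singleton 0), ?_⟩
  rintro t ⟨⟨-, ht⟩, ht0⟩
  exact ⟨ht0, f, hfI, by rw [← hg]; exact ht⟩

theorem geomDeg_polarLocus_firstRows_le {n p : ℕ} (F : Fin p → MvPolynomial (Fin n) ℚ) (ε : ℂ)
    (a : Matrix (Fin (n - p)) (Fin n) ℂ)
    (ha : ∀ i, ∀ _ : 1 ≤ i, ∀ _ : i ≤ n - p,
      IsPureDim (polarLocus F ε (firstRows a (by omega : n - p - i + 1 ≤ n - p)) (n - i))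
        (n - p - i))
    (U : Set (Matrix (Fin (n - p)) (Fin n) ℂ)) (hUopen : ZOpenMat U) (hUne : U.Nonempty)
    (i : ℕ) (h1 : 1 ≤ i) (h2 : i ≤ n - p) {δ : ℕ∞}
    (hU : ∀ b ∈ U,
      IsPureDim (polarLocus F ε (firstRows b (by omega : n - p - i + 1 ≤ n - p)) (n - i))
        (n - p - i) ∧
      geomDeg (zcl (polarLocus F ε (firstRows b (by omega : n - p - i + 1 ≤ n - p)) (n - i))) ≤
        δ) :
    geomDeg (zcl (polarLocus F ε (firstRows a (by omega : n - p - i + 1 ≤ n - p)) (n - i))) ≤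
      δ := by
  obtain ⟨b, hb⟩ := hUne
  obtain ⟨Λ, hΛc, hΛi, hΛ⟩ := hUopen.exists_countable_infinite hb a
  have hr : n - i = p + (n - p - i) := by omega
  have ha' := ha i h1 h2
  rw [hr] at ha' hU ⊢
  obtain ⟨T, hT, hTdim⟩ : ∃ T : Set (Fin n → ℂ),
      (∀ x ∈ SregC F, (polarMat F ε (firstRows a (by omega : n - p - i + 1 ≤ n - p)) x).rank <
        p + (n - p - i) → x ∈ T) ∧
      ∀ P ∈ (vanishingIdeal ℂ T).minimalPrimes,
        ringKrullDim (MvPolynomial (Fin n) ℂ ⧸ P) < ((n - p - i : ℕ) : WithBot ℕ∞) := by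
    rcases h2.eq_or_lt with rfl | hlt
    · refine ⟨∅, fun x hx hlt => ?_, fun P hP =>
        absurd hP (by rw [minimalPrimes_vanishingIdeal_empty]; exact Set.notMem_empty P)⟩
      have := rank_jacC_le F ε (firstRows a (by omega : n - p - (n - p) + 1 ≤ n - p)) x
      rw [hx.2] at this
      omega
    · refine ⟨polarLocus F ε (firstRows a (by omega : n - p - (i + 1) + 1 ≤ n - p)) (n - (i + 1)),
        fun x hx hxlt => ⟨hx, ?_⟩, fun P hP =>
        (ha (i + 1) (by omega) hlt P hP).trans_lt ?_⟩
      · have := rank_polarMat_firstRows_le F ε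
          (firstRows a (by omega : n - p - i + 1 ≤ n - p))
          (by omega : n - p - (i + 1) + 1 ≤ n - p - i + 1) x
        change (polarMat F ε (firstRows a (by omega)) x).rank ≤ _ at this
        omega
      · exact (Nat.cast_lt (α := WithBot ℕ∞)).2 (by omega)
  exact geomDeg_polarLocus_le F ε _ (firstRows (b - a) _) ha' T hT hTdim hΛc hΛi
    (fun t ht => (hΛ t ht).1) (fun t ht => (hU _ (hΛ t ht).2).1)
    fun t ht => (hU _ (hΛ t ht).2).2

end

/-- Theorem 3 of the paper. Let `a` be a complex `(n-p) × n` matrix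
such that for every `1 ≤ i ≤ n-p` the submatrix `a^{(i)}` of the first `n-p-i+1` rows
has maximal rank and the polar varieties `W_{K(a^{(i)})}(S)`, `W_{K̄(ā^{(i)})}(S)` are
empty or of pure codimension `i` in `S`. Let `U` be a nonempty Zariski open set of
`(n-p) × n` matrices `b` whose submatrices `b^{(i)}` have maximal rank and whose polar
varieties are uniformly empty or of codimension `i` in `S`, with fixed geometric degrees
`δc i` and `δd i`. Assume that nonemptiness of `W_{K(a^{(i)})}(S)`
(resp. `W_{K̄(ā^{(i)})}(S)`) implies that of `W_{K(b^{(i)})}(S)`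
(resp. `W_{K̄(b̄^{(i)})}(S)`) for `b ∈ U`. Then for every `1 ≤ i ≤ n-p`:
`deg W_{K(a^{(i)})}(S) ≤ δc i` and `deg W_{K̄(ā^{(i)})}(S) ≤ δd i`. -/
theorem statement17 {n p : ℕ} (hp1 : 1 ≤ p) (hpn : p ≤ n)
    (F : Fin p → MvPolynomial (Fin n) ℚ)
    (hreg : IsRegSeq (List.ofFn F))
    (hrad : idealOfDef F)
    (hSne : (zeroSetC F).Nonempty)
    (hSdim : IsPureDim (zeroSetC F) (n - p))
    (a : Matrix (Fin (n - p)) (Fin n) ℂ)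
    (ha : ∀ i, ∀ h1 : 1 ≤ i, ∀ h2 : i ≤ n - p,
      (firstRows a (by omega : n - p - i + 1 ≤ n - p)).rank = n - p - i + 1 ∧
      (Wclassic F (firstRows a (by omega : n - p - i + 1 ≤ n - p)) (n - i) = ∅ ∨
        IsPureDim (Wclassic F (firstRows a (by omega : n - p - i + 1 ≤ n - p)) (n - i))
          (n - p - i)) ∧
      (Wdual F (firstRows a (by omega : n - p - i + 1 ≤ n - p)) (n - i) = ∅ ∨
        IsPureDim (Wdual F (firstRows a (by omega : n - p - i + 1 ≤ n - p)) (n - i))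
          (n - p - i)))
    (U : Set (Matrix (Fin (n - p)) (Fin n) ℂ))
    (hUopen : ZOpenMat U) (hUne : U.Nonempty)
    (δc δd : ℕ → ℕ∞)
    (hUrank : ∀ b ∈ U, ∀ i, ∀ h1 : 1 ≤ i, ∀ h2 : i ≤ n - p,
      (firstRows b (by omega : n - p - i + 1 ≤ n - p)).rank = n - p - i + 1)
    (hUc : ∀ i, ∀ h1 : 1 ≤ i, ∀ h2 : i ≤ n - p,
      ((∀ b ∈ U, Wclassic F (firstRows b (by omega : n - p - i + 1 ≤ n - p)) (n - i) = ∅) ∨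
       (∀ b ∈ U, IsPureDim
          (Wclassic F (firstRows b (by omega : n - p - i + 1 ≤ n - p)) (n - i)) (n - p - i))) ∧
      (∀ b ∈ U, geomDeg
          (Wclassic F (firstRows b (by omega : n - p - i + 1 ≤ n - p)) (n - i)) = δc i))
    (hUd : ∀ i, ∀ h1 : 1 ≤ i, ∀ h2 : i ≤ n - p,
      ((∀ b ∈ U, Wdual F (firstRows b (by omega : n - p - i + 1 ≤ n - p)) (n - i) = ∅) ∨
       (∀ b ∈ U, IsPureDim
          (Wdual F (firstRows b (by omega : n - p - i + 1 ≤ n - p)) (n - i)) (n - p - i))) ∧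
      (∀ b ∈ U, geomDeg
          (Wdual F (firstRows b (by omega : n - p - i + 1 ≤ n - p)) (n - i)) = δd i))
    (himpl : ∀ i, ∀ h1 : 1 ≤ i, ∀ h2 : i ≤ n - p,
      ((Wclassic F (firstRows a (by omega : n - p - i + 1 ≤ n - p)) (n - i)).Nonempty →
        ∀ b ∈ U,
          (Wclassic F (firstRows b (by omega : n - p - i + 1 ≤ n - p)) (n - i)).Nonempty) ∧
      ((Wdual F (firstRows a (by omega : n - p - i + 1 ≤ n - p)) (n - i)).Nonempty →
        ∀ b ∈ U,
          (Wdual F (firstRows b (by omega : n - p - i + 1 ≤ n - p)) (n - i)).Nonempty)) :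
    ∀ i, ∀ h1 : 1 ≤ i, ∀ h2 : i ≤ n - p,
      geomDeg (Wclassic F (firstRows a (by omega : n - p - i + 1 ≤ n - p)) (n - i)) ≤ δc i ∧
      geomDeg (Wdual F (firstRows a (by omega : n - p - i + 1 ≤ n - p)) (n - i)) ≤ δd i := by
  intro i h1 h2
  simp only [Wclassic_eq, Wdual_eq] at *
  refine ⟨geomDeg_polarLocus_firstRows_le F 0 a (fun i h1 h2 => ?_) U hUopen hUne i h1 h2
    fun b hb => ⟨?_, ?_⟩, geomDeg_polarLocus_firstRows_le F 1 a (fun i h1 h2 => ?_) U hUopen hUne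
    i h1 h2 fun b hb => ⟨?_, ?_⟩⟩
  · exact isPureDim_zcl_iff.1 (isPureDim_of_eq_empty_or (ha i h1 h2).2.1)
  · exact isPureDim_zcl_iff.1 (isPureDim_of_eq_empty_or
      ((hUc i h1 h2).1.imp (fun h => h b hb) fun h => h b hb))
  · exact ((hUc i h1 h2).2 b hb).le
  · exact isPureDim_zcl_iff.1 (isPureDim_of_eq_empty_or (ha i h1 h2).2.2)
  · exact isPureDim_zcl_iff.1 (isPureDim_of_eq_empty_or
      ((hUd i h1 h2).1.imp (fun h => h b hb) fun h => h b hb))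
  · exact ((hUd i h1 h2).2 b hb).le
end
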